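/- Let p be a prime, s ≥ 1, and q = p^s. Let G₁ and G₂ be primitive divergent graphs, and suppose p² divides [Ψ_{G₁}]_p and [Ψ_{G₂}]_p and q² divides [Ψ_{G₁}]_q and [Ψ_{G₂}]_q. If [Ψ_{G₁}]_p / p² ≡ [Ψ_{G₂}]_p / p² (mod p), then [Ψ_{G₁}]_q / q² ≡ [Ψ_{G₂}]_q / q² (mod p); that is, if c₂^{(p)}(G₁) ≡ c₂^{(p)}(G₂) (mod p) then c₂^{(q)}(G₁) ≡ c₂^{(q)}(G₂) (mod p). -/

import Mathlib

open MvPolynomial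

/-- The number of points `x ∈ 𝔽_q^σ`, `q = p^s`, at which the integer polynomial `F`
vanishes (coefficients mapped into the field canonically). -/
noncomputable def pointCount {σ : Type} (p s : ℕ) [Fact p.Prime] (F : MvPolynomial σ ℤ) : ℕ :=
  Nat.card {x : σ → GaloisField p s // MvPolynomial.aeval x F = 0}

-- The Kirchhoff polynomial `Ψ_G = ∑_T ∏_{e ∉ T} α_e`, the sum over spanning trees `T`
-- of `G`, a polynomial in variables indexed by the edges of `G`.
open Classical in
noncomputable def kirchhoff {V : Type} [Fintype V] [DecidableEq V]
    (G : SimpleGraph V) [DecidableRel G.Adj] : MvPolynomial ↥G.edgeFinset ℤ :=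
  ∑ T ∈ G.edgeFinset.powerset.filter
      (fun T => (SimpleGraph.fromEdgeSet (T : Set (Sym2 V))).IsTree),
    ∏ e ∈ Finset.univ.filter (fun e : ↥G.edgeFinset => (e : Sym2 V) ∉ T), X e

/-- A graph is internally 6-edge-connected if removing any set of at most 5 edges
results in at most one connected component containing an edge. -/
def InternallySixEdgeConnected {W : Type} (K : SimpleGraph W) : Prop :=
  ∀ S : Finset (Sym2 W), (S : Set (Sym2 W)) ⊆ K.edgeSet → S.card ≤ 5 →
    ∀ a b c d : W, (K.deleteEdges (S : Set (Sym2 W))).Adj a b →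
      (K.deleteEdges (S : Set (Sym2 W))).Adj c d →
      (K.deleteEdges (S : Set (Sym2 W))).Reachable a c

/-- `G` is primitive divergent: `G` is connected and is the decompletion `K - v` of a
connected, 4-regular, internally 6-edge-connected simple graph `K` (here realized on
vertex set `Option V` with deleted vertex `none`). -/
def IsPrimitiveDivergent {V : Type} [Fintype V] (G : SimpleGraph V) : Prop :=
  G.Connected ∧
  ∃ K : SimpleGraph (Option V),
    K.Connected ∧ (∀ w, (K.neighborSet w).ncard = 4) ∧
    InternallySixEdgeConnected K ∧
    ∀ a b : V, K.Adj (some a) (some b) ↔ G.Adj a b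

section PartA
open MvPolynomial Matrix

def adjq {n A : Type*} [Fintype n] [DecidableEq n] [CommRing A] (D : Matrix n n A) (u v : n → A) : A :=
  u ⬝ᵥ (D.adjugate *ᵥ v)

lemma adjq_map {n A A' : Type*} [Fintype n] [DecidableEq n] [CommRing A] [CommRing A'] (f : A →+* A')
    (D : Matrix n n A) (u v : n → A) : adjq (D.map f) (f ∘ u) (f ∘ v) = f (adjq D u v) := by
  unfold adjq
  have h : f ∘ (D.adjugate *ᵥ v) = (D.map f).adjugate *ᵥ (f ∘ v) := by
    ext i
    rw [← RingHom.mapMatrix_apply f D, ← RingHom.map_adjugate, Function.comp_apply, RingHom.map_mulVec]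
    rfl
  rw [RingHom.map_dotProduct, h]

def Cm {n A : Type*} [CommRing A] (u : Fin 3 → n → A) : Matrix n (Fin 4) A :=
  Matrix.of fun i => ![u 0 i, u 1 i, u 2 i, 0]

def Zm {A : Type*} [CommRing A] (a : Fin 3 → A) : Matrix (Fin 4) (Fin 4) A :=
  !![a 0, 0, 0, 1; 0, a 1, 0, 1; 0, 0, a 2, 1; 1, 1, 1, 0]

def T3 {n A : Type*} [Fintype n] [DecidableEq n] [CommRing A] (D : Matrix n n A)
   (u : Fin 3 → n → A) (a : Fin 3 → A) : A :=
  (fromBlocks D (Cm u) (Cm u)ᵀ (Zm a)).det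

def Ff {n A : Type*} [Fintype n] [DecidableEq n] [CommRing A] (D : Matrix n n A)
   (u : Fin 3 → n → A) (i j k : Fin 3) : A := - adjq D (u i - u j) (u i - u k)

def P3 {n A : Type*} [Fintype n] [DecidableEq n] [CommRing A] (D : Matrix n n A)
   (u : Fin 3 → n → A) (a : Fin 3 → A) : A :=
  T3 D u a - T3 D u 0 + (D.det * (a 0 * a 1 + a 0 * a 2 + a 1 * a 2)
    + (Ff D u 1 0 2 + Ff D u 2 0 1) * a 0 + (Ff D u 0 1 2 + Ff D u 2 0 1) * a 1
    + (Ff D u 0 1 2 + Ff D u 1 0 2) * a 2)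

def Q3 {n A : Type*} [Fintype n] [DecidableEq n] [CommRing A] (D : Matrix n n A)
   (u : Fin 3 → n → A) : A :=
  D.det * T3 D u 0 + (Ff D u 0 1 2 * Ff D u 1 0 2 + Ff D u 0 1 2 * Ff D u 2 0 1 + Ff D u 1 0 2 * Ff D u 2 0 1)

lemma T3_map {n A A' : Type*} [Fintype n] [DecidableEq n] [CommRing A] [CommRing A'] (f : A →+* A')
    (D : Matrix n n A) (u : Fin 3 → n → A) (a : Fin 3 → A) :
    T3 (D.map f) (fun i => f ∘ u i) (f ∘ a) = f (T3 D u a) := by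
  unfold T3
  rw [RingHom.map_det, RingHom.mapMatrix_apply, fromBlocks_map]
  congr 2
  · ext i j; fin_cases j <;> simp [Cm]
  · ext i j; fin_cases i <;> simp [Cm]
  · ext i j; fin_cases i <;> fin_cases j <;> simp [Zm]

lemma Ff_map {n A A' : Type*} [Fintype n] [DecidableEq n] [CommRing A] [CommRing A'] (f : A →+* A')
    (D : Matrix n n A) (u : Fin 3 → n → A) (i j k) :
    Ff (D.map f) (fun i => f ∘ u i) i j k = f (Ff D u i j k) := by
  unfold Ff
  rw [map_neg, ← adjq_map]
  congr 2 <;> ext <;> simp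

lemma P3_map {n A A' : Type*} [Fintype n] [DecidableEq n] [CommRing A] [CommRing A'] (f : A →+* A')
    (D : Matrix n n A) (u : Fin 3 → n → A) (a : Fin 3 → A) :
    P3 (D.map f) (fun i => f ∘ u i) (f ∘ a) = f (P3 D u a) := by
  have h0 : (0 : Fin 3 → A') = f ∘ (0 : Fin 3 → A) := by ext; simp
  unfold P3
  rw [h0, T3_map, T3_map, ← RingHom.mapMatrix_apply, ← RingHom.map_det]
  simp only [RingHom.mapMatrix_apply, Ff_map]
  simp

lemma Q3_map {n A A' : Type*} [Fintype n] [DecidableEq n] [CommRing A] [CommRing A'] (f : A →+* A')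
    (D : Matrix n n A) (u : Fin 3 → n → A) :
    Q3 (D.map f) (fun i => f ∘ u i) = f (Q3 D u) := by
  have h0 : (0 : Fin 3 → A') = f ∘ (0 : Fin 3 → A) := by ext; simp
  unfold Q3
  rw [h0, T3_map, ← RingHom.mapMatrix_apply, ← RingHom.map_det]
  simp only [RingHom.mapMatrix_apply, Ff_map]
  simp

section inv
variable {n K : Type*} [Fintype n] [DecidableEq n] [Field K]

lemma adjq_inv (D : Matrix n n K) (hD : D.det ≠ 0) (u v : n → K) :
    adjq D u v = D.det * (u ⬝ᵥ (D⁻¹ *ᵥ v)) := by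
  unfold adjq
  rw [Matrix.inv_def, Ring.inverse_eq_inv', smul_mulVec, dotProduct_smul, smul_eq_mul, mul_inv_cancel_left₀ hD]

lemma inv_symm (D : Matrix n n K) (hs : Dᵀ = D) (u v : n → K) :
    u ⬝ᵥ (D⁻¹ *ᵥ v) = v ⬝ᵥ (D⁻¹ *ᵥ u) := by
  rw [dotProduct_mulVec, ← mulVec_transpose, transpose_nonsing_inv, hs, dotProduct_comm]

lemma T3_inv (D : Matrix n n K) (hD : D.det ≠ 0) (u : Fin 3 → n → K) (a : Fin 3 → K)
    (w : Fin 3 → Fin 3 → K) (hw : ∀ i j, w i j = u i ⬝ᵥ (D⁻¹ *ᵥ u j)) :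
    T3 D u a = D.det * (!![a 0 - w 0 0, - w 0 1, - w 0 2, 1;
      - w 1 0, a 1 - w 1 1, - w 1 2, 1; - w 2 0, - w 2 1, a 2 - w 2 2, 1; 1, 1, 1, 0] :
        Matrix (Fin 4) (Fin 4) K).det := by
  unfold T3
  have : Invertible D := Matrix.invertibleOfIsUnitDet D (isUnit_iff_ne_zero.2 hD)
  rw [det_fromBlocks₁₁]
  congr 2
  rw [Matrix.mul_assoc, invOf_eq_nonsing_inv]
  have h : ∀ j : Fin 4, (D⁻¹ * Cm u).col j = D⁻¹ *ᵥ ((Cm u).col j) := by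
    intro j; ext i; simp [Matrix.mul_apply, mulVec, dotProduct, Matrix.col]
  have hc : ∀ j : Fin 4, (Cm u).col j = ![u 0, u 1, u 2, 0] j := by
    intro j; ext i; fin_cases j <;> simp [Cm, Matrix.col]
  have h2 : ∀ i j, ((Cm u)ᵀ * (D⁻¹ * Cm u)) i j = ![u 0, u 1, u 2, 0] i ⬝ᵥ (D⁻¹ *ᵥ ![u 0, u 1, u 2, 0] j) := by
    intro i j
    rw [← hc, ← hc, ← h]; rfl
  ext i j
  rw [Matrix.sub_apply, h2]
  fin_cases i <;> fin_cases j <;> simp [Zm, hw]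

lemma det4 (a : Fin 3 → K) (w : Fin 3 → Fin 3 → K) (hw : ∀ i j, w i j = w j i) :
   (!![a 0 - w 0 0, - w 0 1, - w 0 2, 1;
      - w 1 0, a 1 - w 1 1, - w 1 2, 1; - w 2 0, - w 2 1, a 2 - w 2 2, 1; 1, 1, 1, 0] :
        Matrix (Fin 4) (Fin 4) K).det = - ((a 0 - w 0 0) * (a 1 - w 1 1) - w 0 1 ^ 2
         + (a 0 - w 0 0) * (a 2 - w 2 2) - w 0 2 ^ 2 + (a 1 - w 1 1) * (a 2 - w 2 2) - w 1 2 ^ 2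
         + 2 * (w 0 1 * (a 2 - w 2 2) + w 0 2 * (a 1 - w 1 1) + w 1 2 * (a 0 - w 0 0)) 
         - 2 * (w 0 1 * w 0 2 + w 0 1 * w 1 2 + w 0 2 * w 1 2)
         + 4 * (w 0 1 * w 0 2 + w 0 1 * w 1 2 + w 0 2 * w 1 2)) := by
  rw [hw 1 0, hw 2 0, hw 2 1]
  simp [Matrix.det_succ_row_zero, Fin.sum_univ_succ, Fin.succAbove]
  ring

lemma PQ3_inv (D : Matrix n n K) (hD : D.det ≠ 0) (hs : Dᵀ = D) (u : Fin 3 → n → K) (a : Fin 3 → K) :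
    P3 D u a = 0 ∧ Q3 D u = 0 := by
  obtain ⟨w, hw⟩ : ∃ w : Fin 3 → Fin 3 → K, ∀ i j, w i j = u i ⬝ᵥ (D⁻¹ *ᵥ u j) := ⟨_, fun _ _ => rfl⟩
  have hws : ∀ i j, w i j = w j i := fun i j => by rw [hw, hw, inv_symm D hs]
  constructor
  all_goals
    simp only [P3, Q3, T3_inv D hD u _ w hw, Ff, adjq_inv D hD, mulVec_sub, dotProduct_sub, sub_dotProduct,
      det4 _ w hws]
    simp only [← hw, hws 1 0, hws 2 0, hws 2 1, Pi.zero_apply]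
    ring
end inv


open Polynomial in
lemma ttrick {n K : Type*} [Fintype n] [DecidableEq n] [Field K] (D : Matrix n n K) (hs : Dᵀ = D)
    (FK : Matrix n n K → K) (FX : Matrix n n K[X] → K[X]) (FR : Matrix n n (RatFunc K) → RatFunc K)
    (hK : ∀ D, FK (D.map (Polynomial.evalRingHom 0)) = Polynomial.evalRingHom 0 (FX D))
    (hR : ∀ D, FR (D.map (algebraMap K[X] (RatFunc K))) = algebraMap K[X] (RatFunc K) (FX D))
    (h : ∀ D, D.det ≠ 0 → Dᵀ = D → FR D = 0) : FK D = 0 := by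
  let D1 : Matrix n n K[X] := D.map Polynomial.C + (Polynomial.X : K[X]) • 1
  have hD1 : D1.det ≠ 0 := by
    have : D1 = charmatrix (-D) := by
      ext i j
      by_cases h : i = j
      · subst h; simp [D1, charmatrix, add_comm]
      · simp [D1, charmatrix, h]
    rw [this]
    exact (Matrix.charpoly_monic (-D)).ne_zero
  have hs1 : D1ᵀ = D1 := by
    ext i j
    have : D j i = D i j := congrFun (congrFun hs i) j
    simp [D1, this, Matrix.one_apply, eq_comm]
  let f : K[X] →+* RatFunc K := algebraMap _ _
  have hf : Function.Injective f := IsFractionRing.injective _ _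
  let g : K[X] →+* K := Polynomial.evalRingHom 0
  have hg : D1.map g = D := by
    ext i j; by_cases h : i = j <;> simp [D1, g, h]
  have h2 := h (D1.map f) (by
    rw [← RingHom.mapMatrix_apply, ← RingHom.map_det]
    exact (map_ne_zero_iff f hf).2 hD1) (by rw [← Matrix.transpose_map, hs1])
  rw [hR, map_eq_zero_iff _ hf] at h2
  have := hK D1
  rw [h2, map_zero] at this
  rw [← hg]; exact this

open Polynomial in
lemma PQ3 {n K : Type*} [Fintype n] [DecidableEq n] [Field K] (D : Matrix n n K) (hs : Dᵀ = D)
    (u : Fin 3 → n → K) (a : Fin 3 → K) : P3 D u a = 0 ∧ Q3 D u = 0 := by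
  let u1 : Fin 3 → n → K[X] := fun i => Polynomial.C ∘ u i
  let a1 : Fin 3 → K[X] := Polynomial.C ∘ a
  have hgu : (fun i => Polynomial.evalRingHom 0 ∘ u1 i) = u := by ext; simp [u1]
  have hga : Polynomial.evalRingHom 0 ∘ a1 = a := by ext; simp [a1]
  constructor
  · refine ttrick D hs (P3 · u a) (P3 · u1 a1)
      (P3 · (fun i => algebraMap _ _ ∘ u1 i) (algebraMap _ _ ∘ a1)) ?_ ?_ ?_
    · intro D; rw [← P3_map, hgu, hga]
    · intro D; rw [← P3_map]
    · intro D h1 h2; exact (PQ3_inv D h1 h2 _ _).1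
  · refine ttrick D hs (Q3 · u) (Q3 · u1)
      (Q3 · (fun i => algebraMap _ _ ∘ u1 i)) ?_ ?_ ?_
    · intro D; rw [← Q3_map, hgu]
    · intro D; rw [← Q3_map]
    · intro D h1 h2; exact (PQ3_inv D h1 h2 _ 0).2

/-- one extra column -/
def T1 {n A : Type*} [Fintype n] [DecidableEq n] [CommRing A] (D : Matrix n n A)
   (u : n → A) (a : A) : A :=
  (fromBlocks D (Matrix.of fun i (_ : Unit) => u i) (Matrix.of fun (_ : Unit) i => u i) (Matrix.of fun _ _ => a)).det

lemma T1_map {n A A' : Type*} [Fintype n] [DecidableEq n] [CommRing A] [CommRing A'] (f : A →+* A')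
    (D : Matrix n n A) (u : n → A) (a : A) :
    T1 (D.map f) (f ∘ u) (f a) = f (T1 D u a) := by
  unfold T1
  rw [RingHom.map_det, RingHom.mapMatrix_apply, fromBlocks_map]
  congr 2

open Polynomial in
lemma T1_eq {n K : Type*} [Fintype n] [DecidableEq n] [Field K] (D : Matrix n n K) (hs : Dᵀ = D)
    (u : n → K) (a : K) : T1 D u a = a * D.det - adjq D u u := by
  rw [← sub_eq_zero]
  have hgu : (Polynomial.evalRingHom 0 ∘ Polynomial.C ∘ u) = u := by ext; simp
  refine ttrick D hs (fun D => T1 D u a - (a * D.det - adjq D u u))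
    (fun D => T1 D (Polynomial.C ∘ u) (Polynomial.C a) - (Polynomial.C a * D.det - adjq D (Polynomial.C ∘ u) (Polynomial.C ∘ u)))
    (fun D => T1 D (algebraMap _ _ ∘ Polynomial.C ∘ u) (algebraMap _ _ (Polynomial.C a))
      - (algebraMap _ _ (Polynomial.C a) * D.det - adjq D (algebraMap _ _ ∘ Polynomial.C ∘ u) (algebraMap _ _ ∘ Polynomial.C ∘ u)))
    ?_ ?_ ?_
  · intro D
    rw [map_sub, map_sub, map_mul, ← T1_map, ← adjq_map, RingHom.map_det, hgu]
    simp
  · intro D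
    rw [map_sub, map_sub, map_mul, ← T1_map, ← adjq_map, RingHom.map_det]
    simp
  · intro D hD _
    generalize (algebraMap _ _ ∘ Polynomial.C ∘ u : n → RatFunc K) = u
    generalize (algebraMap _ _ (Polynomial.C a) : RatFunc K) = a
    have : Invertible D := Matrix.invertibleOfIsUnitDet D (isUnit_iff_ne_zero.2 hD)
    rw [T1, det_fromBlocks₁₁, adjq_inv D hD, Matrix.mul_assoc, invOf_eq_nonsing_inv, det_unique (n := Unit)]
    simp only [Matrix.sub_apply, Matrix.of_apply]
    have : ((Matrix.of fun (_ : Unit) i => u i) * (D⁻¹ * (Matrix.of fun i (_ : Unit) => u i))) default default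
      = u ⬝ᵥ (D⁻¹ *ᵥ u) := rfl
    rw [this]; ring

/-- a two-valent vertex -/
def T2 {n A : Type*} [Fintype n] [DecidableEq n] [CommRing A] (D : Matrix n n A)
   (u v : n → A) (a b : A) : A :=
  (fromBlocks D (Matrix.of fun i => ![u i, v i, 0]) (Matrix.of fun i => ![u i, v i, 0])ᵀ !![a, 0, 1; 0, b, 1; 1, 1, 0]).det

lemma T2_map {n A A' : Type*} [Fintype n] [DecidableEq n] [CommRing A] [CommRing A'] (f : A →+* A')
    (D : Matrix n n A) (u v : n → A) (a b : A) :
    T2 (D.map f) (f ∘ u) (f ∘ v) (f a) (f b) = f (T2 D u v a b) := by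
  unfold T2
  rw [RingHom.map_det, RingHom.mapMatrix_apply, fromBlocks_map]
  congr 2
  · ext i j; fin_cases j <;> simp
  · ext i j; fin_cases i <;> simp
  · ext i j; fin_cases i <;> fin_cases j <;> simp

open Polynomial in
lemma T2_eq {n K : Type*} [Fintype n] [DecidableEq n] [Field K] (D : Matrix n n K) (hs : Dᵀ = D)
    (u v : n → K) (a b : K) : T2 D u v a b = - ((a + b) * D.det - adjq D (u - v) (u - v)) := by
  rw [← sub_eq_zero]
  have hgu : ∀ u : n → K, (Polynomial.evalRingHom 0 ∘ Polynomial.C ∘ u) = u := by intro u; ext; simp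
  refine ttrick D hs (fun D => T2 D u v a b - -((a + b) * D.det - adjq D (u - v) (u - v)))
    (fun D => T2 D (Polynomial.C ∘ u) (Polynomial.C ∘ v) (Polynomial.C a) (Polynomial.C b)
      - - ((Polynomial.C a + Polynomial.C b) * D.det - adjq D (Polynomial.C ∘ (u - v)) (Polynomial.C ∘ (u - v))))
    (fun D => T2 D (algebraMap _ _ ∘ Polynomial.C ∘ u) (algebraMap _ _ ∘ Polynomial.C ∘ v)
       (algebraMap _ _ (Polynomial.C a)) (algebraMap _ _ (Polynomial.C b))
      - - ((algebraMap _ _ (Polynomial.C a) + algebraMap _ _ (Polynomial.C b)) * D.det - adjq D (algebraMap _ _ ∘ Polynomial.C ∘ (u - v)) (algebraMap _ _ ∘ Polynomial.C ∘ (u - v))))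
    ?_ ?_ ?_
  · intro D
    rw [map_sub, map_neg, map_sub, map_mul, ← T2_map, ← adjq_map, RingHom.map_det, hgu, hgu, hgu]
    simp
  · intro D
    rw [map_sub, map_neg, map_sub, map_mul, ← T2_map, ← adjq_map, RingHom.map_det]
    simp
  · intro D hD hsD
    have huv : (algebraMap _ _ ∘ Polynomial.C ∘ (u - v) : n → RatFunc K) =
      algebraMap _ _ ∘ Polynomial.C ∘ u - algebraMap _ _ ∘ Polynomial.C ∘ v := by ext; simp
    rw [huv]
    generalize (algebraMap _ _ ∘ Polynomial.C ∘ u : n → RatFunc K) = u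
    generalize (algebraMap _ _ ∘ Polynomial.C ∘ v : n → RatFunc K) = v
    generalize (algebraMap _ _ (Polynomial.C a) : RatFunc K) = a
    generalize (algebraMap _ _ (Polynomial.C b) : RatFunc K) = b
    have : Invertible D := Matrix.invertibleOfIsUnitDet D (isUnit_iff_ne_zero.2 hD)
    rw [T2, det_fromBlocks₁₁, adjq_inv D hD, Matrix.mul_assoc, invOf_eq_nonsing_inv]
    set C : Matrix n (Fin 3) (RatFunc K) := Matrix.of fun i => ![u i, v i, 0] with hC
    have h : ∀ j : Fin 3, (D⁻¹ * C).col j = D⁻¹ *ᵥ (C.col j) := by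
      intro j; ext i; simp [Matrix.mul_apply, mulVec, dotProduct, Matrix.col]
    have hc : ∀ j : Fin 3, C.col j = ![u, v, 0] j := by
      intro j; ext i; fin_cases j <;> simp [hC, Matrix.col]
    have h2 : ∀ i j, (Cᵀ * (D⁻¹ * C)) i j = ![u, v, 0] i ⬝ᵥ (D⁻¹ *ᵥ ![u, v, 0] j) := by
      intro i j
      rw [← hc, ← hc, ← h]; rfl
    rw [Matrix.det_fin_three]
    simp only [Matrix.sub_apply, h2]
    simp [mulVec_sub, inv_symm D hsD v u]
    ring
end PartA

section PartB
open MvPolynomial Matrix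

section
variable {R E A : Type*} [Fintype R] [DecidableEq R] [Fintype E] [DecidableEq E] [CommRing A]

def Dm (B : Matrix R E ℤ) (x : E → A) : Matrix (E ⊕ R) (E ⊕ R) A :=
  fromBlocks (diagonal x) (B.map (Int.cast : ℤ → A))ᵀ (B.map (Int.cast : ℤ → A)) 0

def Phi (B : Matrix R E ℤ) (x : E → A) : A := (Dm B x).det

lemma Dm_symm (B : Matrix R E ℤ) (x : E → A) : (Dm B x)ᵀ = Dm B x := by
  simp [Dm, fromBlocks_transpose]

lemma Phi_reindex {R' E' : Type*} [Fintype R'] [DecidableEq R'] [Fintype E'] [DecidableEq E']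
    (B : Matrix R E ℤ) (x : E → A) (f : R' ≃ R) (g : E' ≃ E) :
    Phi (B.submatrix f g) (x ∘ g) = Phi B x := by
  unfold Phi
  rw [← det_submatrix_equiv_self (Equiv.sumCongr g f)]
  congr 1
  ext i j
  rcases i with i | i <;> rcases j with j | j <;> simp [Dm, diagonal_apply]

lemma Phi_sign (B : Matrix R E ℤ) (x : E → A) (s : E → ℤ) (hs : ∀ e, s e * s e = 1) :
    Phi (Matrix.of fun r e => B r e * s e) x = Phi B x := by
  unfold Phi
  have : Dm (Matrix.of fun r e => B r e * s e) x =
    diagonal (Sum.elim (fun e => (s e : A)) 1) * Dm B x * diagonal (Sum.elim (fun e => (s e : A)) 1) := by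
    have hs' : ∀ e, (s e : A) * s e = 1 := fun e => by exact_mod_cast congrArg (Int.cast : ℤ → A) (hs e)
    ext i j
    rw [mul_diagonal, diagonal_mul]
    rcases i with i | i <;> rcases j with j | j <;> simp [Dm, diagonal_apply]
    · split_ifs with h
      · subst h; rw [mul_right_comm, hs', one_mul]
      · rfl
    · ring
  rw [this, det_mul, det_mul, mul_right_comm, ← det_mul, diagonal_mul_diagonal]
  have : (diagonal fun i : E ⊕ R => Sum.elim (fun e => (s e : A)) 1 i * Sum.elim (fun e => (s e : A)) 1 i) = 1 := by
    rw [← diagonal_one]; congr 1; ext i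
    rcases i with i | i <;> simp
    exact_mod_cast congrArg (Int.cast : ℤ → A) (hs i)
  rw [this, det_one, one_mul]

def eq3 (E R : Type*) : (E ⊕ R) ⊕ Fin 4 ≃ (Fin 3 ⊕ E) ⊕ (Unit ⊕ R) where
  toFun := Sum.elim (Sum.elim (fun e => .inl (.inr e)) (fun r => .inr (.inr r)))
    ![.inl (.inl 0), .inl (.inl 1), .inl (.inl 2), .inr (.inl ())]
  invFun := Sum.elim (Sum.elim ![.inr 0, .inr 1, .inr 2] (fun e => .inl (.inl e)))
    (Sum.elim (fun _ => .inr 3) (fun r => .inl (.inr r)))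
  left_inv := by
    rintro ((e | r) | k)
    · rfl
    · rfl
    · fin_cases k <;> rfl
  right_inv := by
    rintro ((e | r) | (k | k))
    · fin_cases e <;> rfl
    · rfl
    · rfl
    · rfl

def eq2 (E R : Type*) : (E ⊕ R) ⊕ Fin 3 ≃ (Fin 2 ⊕ E) ⊕ (Unit ⊕ R) where
  toFun := Sum.elim (Sum.elim (fun e => .inl (.inr e)) (fun r => .inr (.inr r)))
    ![.inl (.inl 0), .inl (.inl 1), .inr (.inl ())]
  invFun := Sum.elim (Sum.elim ![.inr 0, .inr 1] (fun e => .inl (.inl e)))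
    (Sum.elim (fun _ => .inr 2) (fun r => .inl (.inr r)))
  left_inv := by
    rintro ((e | r) | k)
    · rfl
    · rfl
    · fin_cases k <;> rfl
  right_inv := by
    rintro ((e | r) | (k | k))
    · fin_cases e <;> rfl
    · rfl
    · rfl
    · rfl

def eq1 (E R : Type*) : (E ⊕ R) ⊕ Unit ≃ (Unit ⊕ E) ⊕ R where
  toFun := Sum.elim (Sum.elim (fun e => .inl (.inr e)) (fun r => .inr r)) fun _ => .inl (.inl ())
  invFun := Sum.elim (Sum.elim (fun _ => .inr ()) (fun e => .inl (.inl e)))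
    (fun r => .inl (.inr r))
  left_inv := by
    rintro ((e | r) | k) <;> rfl
  right_inv := by
    rintro ((e | r) | k) <;> rfl

lemma Phi_S3 (B : Matrix (Unit ⊕ R) (Fin 3 ⊕ E) ℤ) (h1 : ∀ i, B (.inl ()) (.inl i) = 1)
    (h0 : ∀ e, B (.inl ()) (.inr e) = 0) (x : Fin 3 ⊕ E → A) :
    Phi B x = T3 (Dm (B.submatrix .inr .inr) (x ∘ .inr))
      (fun i => Sum.elim 0 (fun r => (B (.inr r) (.inl i) : A))) (x ∘ .inl) := by
  unfold Phi T3
  rw [← det_submatrix_equiv_self (eq3 E R)]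
  congr 1
  ext i j
  rcases i with (i | i) | i <;> rcases j with (j | j) | j
  all_goals try fin_cases i
  all_goals try fin_cases j
  all_goals simp [Dm, eq3, Cm, Zm, diagonal_apply, h1, h0]

lemma Phi_S2 (B : Matrix (Unit ⊕ R) (Fin 2 ⊕ E) ℤ) (h1 : ∀ i, B (.inl ()) (.inl i) = 1)
    (h0 : ∀ e, B (.inl ()) (.inr e) = 0) (x : Fin 2 ⊕ E → A) :
    Phi B x = T2 (Dm (B.submatrix .inr .inr) (x ∘ .inr))
      (Sum.elim 0 (fun r => (B (.inr r) (.inl 0) : A))) (Sum.elim 0 (fun r => (B (.inr r) (.inl 1) : A)))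
      (x (.inl 0)) (x (.inl 1)) := by
  unfold Phi T2
  rw [← det_submatrix_equiv_self (eq2 E R)]
  congr 1
  ext i j
  rcases i with (i | i) | i <;> rcases j with (j | j) | j
  all_goals try fin_cases i
  all_goals try fin_cases j
  all_goals simp [Dm, eq2, diagonal_apply, h1, h0]

lemma Phi_S1 (B : Matrix R (Unit ⊕ E) ℤ) (x : Unit ⊕ E → A) :
    Phi B x = T1 (Dm (B.submatrix id .inr) (x ∘ .inr))
      (Sum.elim 0 (fun r => (B r (.inl ()) : A)))
      (x (.inl ())) := by
  unfold Phi T1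
  rw [← det_submatrix_equiv_self (eq1 E R)]
  congr 1
  ext i j
  rcases i with (i | i) | i <;> rcases j with (j | j) | j
  all_goals simp [Dm, eq1, diagonal_apply]

/-- degree bound -/
lemma det_degree {k : Type*} [CommRing k] (D : Matrix (E ⊕ R) (E ⊕ R) (MvPolynomial E k)) (t : ℕ) (S : Finset R)
    (hS : S.card ≤ t)
    (hEE : ∀ i j, (D (.inl i) (.inl j)).totalDegree ≤ 1)
    (hER : ∀ i j, (D (.inl i) (.inr j)).totalDegree = 0)
    (hRE : ∀ i j, (D (.inr i) (.inl j)).totalDegree = 0)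
    (hRR : ∀ i j, (D (.inr i) (.inr j)).totalDegree = 0)
    (hz : ∀ i j, i ∉ S → D (.inr i) (.inr j) = 0) :
    D.det.totalDegree ≤ Fintype.card E + t - Fintype.card R := by
  rw [det_apply]
  refine (totalDegree_finsetSum _ _).trans (Finset.sup_le fun σ _ => ?_)
  by_cases hzero : ∏ i, D (σ i) i = 0
  · simp [hzero]
  refine (totalDegree_smul_le _ _).trans ?_
  refine (totalDegree_finsetProd _ _).trans ?_
  have hne : ∀ i, D (σ i) i ≠ 0 := fun i h => hzero (Finset.prod_eq_zero (Finset.mem_univ i) h)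
  have hle : ∀ i, (D (σ i) i).totalDegree ≤ if (i.isLeft ∧ (σ i).isLeft) then 1 else 0 := by
    intro i
    rcases h : σ i with j | j <;> rcases i with i | i <;> simp [hEE, hER, hRE, hRR]
  refine (Finset.sum_le_sum fun i _ => hle i).trans ?_
  rw [Finset.sum_boole]
  simp only [Nat.cast_id]
  set LL := Finset.univ.filter fun i : E ⊕ R => (i.isLeft ∧ (σ i).isLeft)
  set LR := Finset.univ.filter fun i : E ⊕ R => (i.isLeft ∧ (σ i).isRight)
  set RR := Finset.univ.filter fun i : E ⊕ R => (i.isRight ∧ (σ i).isRight)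
  have c1 : LL.card + LR.card = Fintype.card E := by
    rw [← Finset.card_union_of_disjoint]
    · have : LL ∪ LR = Finset.univ.map ⟨Sum.inl, Sum.inl_injective⟩ := by
        ext i; rcases h : σ i with j | j <;> rcases i with i | i <;> simp [LL, LR, h]
      rw [this, Finset.card_map, Finset.card_univ]
    · rw [Finset.disjoint_left]; intro i; rcases h : σ i with j | j <;> simp [LL, LR, h]
  have c2 : RR.card + LR.card = Fintype.card R := by
    rw [← Finset.card_union_of_disjoint]
    · have : (RR ∪ LR).map σ.toEmbedding = Finset.univ.map ⟨Sum.inr, Sum.inr_injective⟩ := by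
        ext i
        obtain ⟨i, rfl⟩ := σ.surjective i
        simp only [Finset.mem_map_equiv, Equiv.symm_apply_apply]
        rcases h : σ i with j | j <;> rcases i with i | i <;> simp [RR, LR, h]
      rw [← Finset.card_map σ.toEmbedding, this, Finset.card_map, Finset.card_univ]
    · rw [Finset.disjoint_left]; intro i; rcases i with j | j <;> simp [RR, LR]
  have c3 : RR.card ≤ S.card := by
    rw [← Finset.card_map σ.toEmbedding, ← Finset.card_map (s := S) ⟨(Sum.inr : R → E ⊕ R), Sum.inr_injective⟩]
    apply Finset.card_le_card
    intro i
    obtain ⟨i, rfl⟩ := σ.surjective i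
    simp only [Finset.mem_map_equiv, Equiv.symm_apply_apply]
    intro hi
    have := hne i
    rcases h : σ i with j | j <;> rcases i with i | i <;> simp [RR, h] at hi ⊢
    by_contra hj
    rw [h] at this
    exact this (hz _ _ hj)
  omega

noncomputable def PhiP (k : Type*) [CommRing k] (B : Matrix R E ℤ) : MvPolynomial E k := Phi B X

noncomputable def AdjP (k : Type*) [CommRing k] (B : Matrix R E ℤ) (a b : R) : MvPolynomial E k :=
  (Dm B (X : E → MvPolynomial E k)).adjugate (.inr a) (.inr b)

lemma Dm_map {A' : Type*} [CommRing A'] (f : A →+* A') (B : Matrix R E ℤ) (x : E → A) :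
    (Dm B x).map f = Dm B (f ∘ x) := by
  ext i j
  rcases i with i | i <;> rcases j with j | j <;> simp [Dm, diagonal_apply]
  split_ifs <;> simp

lemma PhiP_hom {k : Type*} [CommRing k] (f : MvPolynomial E k →+* A) (B : Matrix R E ℤ) :
    f (PhiP k B) = Phi B (f ∘ X) := by
  unfold PhiP Phi
  rw [RingHom.map_det, RingHom.mapMatrix_apply, Dm_map]

lemma AdjP_hom {k : Type*} [CommRing k] (f : MvPolynomial E k →+* A) (B : Matrix R E ℤ) (a b : R) :
    f (AdjP k B a b) = (Dm B (f ∘ X)).adjugate (.inr a) (.inr b) := by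
  unfold AdjP
  rw [← Dm_map, ← RingHom.mapMatrix_apply, ← RingHom.map_adjugate]
  rfl

lemma PhiP_degree (k : Type*) [CommRing k] [Nontrivial k] (B : Matrix R E ℤ) :
    (PhiP k B).totalDegree ≤ Fintype.card E - Fintype.card R := by
  refine det_degree _ 0 ∅ (by simp) ?_ ?_ ?_ ?_ ?_
  · intro i j
    simp only [Dm, fromBlocks_apply₁₁, diagonal_apply]
    split_ifs
    · exact (totalDegree_X _).le
    · simp
  all_goals intro i j
  all_goals simp [Dm]
  all_goals exact totalDegree_C _

lemma AdjP_degree (k : Type*) [CommRing k] [Nontrivial k] (B : Matrix R E ℤ) (a b : R) :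
    (AdjP k B a b).totalDegree ≤ Fintype.card E + 1 - Fintype.card R := by
  unfold AdjP
  rw [adjugate_apply]
  refine det_degree _ 1 {b} (by simp) ?_ ?_ ?_ ?_ ?_
  · intro i j
    rw [updateRow_ne (by simp)]
    simp only [Dm, fromBlocks_apply₁₁, diagonal_apply]
    split_ifs
    · exact (totalDegree_X _).le
    · simp
  · intro i j
    rw [updateRow_ne (by simp)]
    simp only [Dm, fromBlocks_apply₁₂, transpose_apply, map_apply]
    exact totalDegree_C _
  · intro i j
    rw [updateRow_apply]
    split_ifs
    · simp
    · exact totalDegree_C _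
  · intro i j
    rw [updateRow_apply]
    split_ifs
    · rw [Pi.single_apply]; split_ifs <;> simp
    · simp [Dm]
  · intro i j h
    rw [updateRow_ne (by simpa using h)]
    simp [Dm]
end
end PartB

section PartC
open MvPolynomial Matrix

section counting
open Classical in
noncomputable def ind (P : Prop) : ℤ := if P then 1 else 0

lemma ind_true {P : Prop} (h : P) : ind P = 1 := if_pos h
lemma ind_false {P : Prop} (h : ¬ P) : ind P = 0 := if_neg h

noncomputable def cnt {α : Type*} [Fintype α] (P : α → Prop) : ℤ := ∑ x, ind (P x)

lemma cnt_congr {α : Type*} [Fintype α] {P Q : α → Prop} (h : ∀ x, P x ↔ Q x) : cnt P = cnt Q := by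
  unfold cnt; simp_rw [h]

lemma cnt_equiv {α β : Type*} [Fintype α] [Fintype β] (e : α ≃ β) (P : β → Prop) :
    cnt (fun x => P (e x)) = cnt P := by
  unfold cnt; exact Equiv.sum_comp e (fun x => ind (P x))

lemma cnt_eq_card {α : Type*} [Fintype α] (P : α → Prop) : cnt P = Nat.card {x // P x} := by
  classical
  unfold cnt ind
  rw [Finset.sum_boole, Nat.card_eq_fintype_card, Fintype.card_subtype]

variable {F : Type*} [Field F] [Fintype F] 
local notation "q" => (Fintype.card F : ℤ)

lemma cnt_sum {S E : Type*} [Fintype S] [Fintype E] [DecidableEq S] [DecidableEq E] (P : (S ⊕ E → F) → Prop) :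
    cnt P = ∑ y : E → F, cnt (fun a : S → F => P (Sum.elim a y)) := by
  unfold cnt
  rw [← Equiv.sum_comp (Equiv.sumArrowEquivProdArrow S E F).symm, Fintype.sum_prod_type_right]
  rfl

open Classical in
lemma cnt_lin (a b : F) : ∑ c : F, ind (a * c + b = 0) = if a = 0 then (if b = 0 then q else 0) else 1 := by
  classical
  split_ifs with h1 h2
  · subst h1 h2; simp [ind]
  · subst h1; simp [ind, h2]
  · rw [Finset.sum_eq_single (-b / a)]
    · apply ind_true; field_simp; ring
    · intro c _ hc; apply ind_false; intro h; apply hc; field_simp; linear_combination h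
    · simp

def e3 : (Fin 3 → F) ≃ F × F × F where
  toFun f := (f 0, f 1, f 2)
  invFun t := ![t.1, t.2.1, t.2.2]
  left_inv f := by ext i; fin_cases i <;> rfl
  right_inv t := rfl

def e2 : (Fin 2 → F) ≃ F × F where
  toFun f := (f 0, f 1)
  invFun t := ![t.1, t.2]
  left_inv f := by ext i; fin_cases i <;> rfl
  right_inv t := rfl

lemma fib_lin (L0 L1 L2 g : F) (h : ¬ (L0 = 0 ∧ L1 = 0 ∧ L2 = 0)) :
    ∑ a : F, ∑ b : F, ∑ c : F, ind (L2 * c + (L1 * b + (L0 * a + g)) = 0) = q ^ 2 := by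
  classical
  simp_rw [cnt_lin]
  by_cases h2 : L2 = 0
  · simp only [h2, if_true]
    have : ∀ a b : F, (if L1 * b + (L0 * a + g) = 0 then q else 0) = q * ind (L1 * b + (L0 * a + g) = 0) := by
      intro a b; unfold ind; split_ifs <;> simp
    simp_rw [this, ← Finset.mul_sum, cnt_lin]
    by_cases h1 : L1 = 0
    · simp only [h1, if_true]
      have h0 : L0 ≠ 0 := by tauto
      have : ∀ a : F, (if L0 * a + g = 0 then q else 0) = q * ind (L0 * a + g = 0) := by
        intro a; unfold ind; split_ifs <;> simp
      simp_rw [this, ← Finset.mul_sum, cnt_lin, if_neg h0]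
      ring
    · simp only [h1, if_false]
      simp
      ring
  · simp only [h2, if_false]
    simp
    ring

lemma fib3 (f0 F1 F2 F3 g : F) (h : f0 * g = F1 * F2 + F1 * F3 + F2 * F3) :
    cnt (fun a : Fin 3 → F => f0 * (a 0 * a 1 + a 0 * a 2 + a 1 * a 2) + (F2 + F3) * a 0
      + (F1 + F3) * a 1 + (F1 + F2) * a 2 + g = 0) =
    q ^ 2 - q ^ 2 * ind (f0 = 0 ∧ F1 = 0 ∧ F2 = 0 ∧ F3 = 0)
      + q ^ 3 * ind ((f0 = 0 ∧ F1 = 0 ∧ F2 = 0 ∧ F3 = 0) ∧ g = 0) := by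
  classical
  have hc : cnt (fun a : Fin 3 → F => f0 * (a 0 * a 1 + a 0 * a 2 + a 1 * a 2) + (F2 + F3) * a 0
      + (F1 + F3) * a 1 + (F1 + F2) * a 2 + g = 0)
      = ∑ a : F, ∑ b : F, ∑ c : F, ind ((f0 * (a + b) + (F1 + F2)) * c + (f0 * (a * b) + (F2 + F3) * a + (F1 + F3) * b + g) = 0) := by
    rw [← cnt_equiv (e3 (F := F)).symm]
    unfold cnt
    rw [Fintype.sum_prod_type]
    refine Finset.sum_congr rfl fun a _ => ?_
    rw [Fintype.sum_prod_type]
    refine Finset.sum_congr rfl fun b _ => Finset.sum_congr rfl fun c _ => ?_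
    congr 1
    have he : (e3.symm (a, b, c) : Fin 3 → F) = ![a, b, c] := rfl
    beta_reduce
    rw [he]
    simp only [cons_val]
    congr! 1
    ring
  rw [hc]
  by_cases h0 : f0 = 0
  · subst h0
    by_cases hL : F2 + F3 = 0 ∧ F1 + F3 = 0 ∧ F1 + F2 = 0
    · obtain ⟨h1, h2, h3⟩ := hL
      have e2 : F2 = - F3 := by linear_combination h1
      have e1 : F1 = - F3 := by linear_combination h2
      have e3 : F3 = 0 := by
        rw [e1, e2] at h
        have : F3 ^ 2 = 0 := by linear_combination h
        exact pow_eq_zero_iff (two_ne_zero) |>.1 this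
      rw [e3, neg_zero] at e1 e2
      subst e1 e2 e3
      by_cases hg : g = 0
      · subst hg; simp [ind]; ring
      · simp [ind, hg]
    · have hn : ¬ (F1 = 0 ∧ F2 = 0 ∧ F3 = 0) := by
        rintro ⟨rfl, rfl, rfl⟩; simp at hL
      rw [ind_false (by tauto), ind_false (by tauto)]
      rw [mul_zero, mul_zero, add_zero, sub_zero, ← fib_lin _ _ _ g hL]
      refine Finset.sum_congr rfl fun a _ => Finset.sum_congr rfl fun b _ => Finset.sum_congr rfl fun c _ => ?_
      congr 1
      ring_nf
  · rw [ind_false (by tauto), ind_false (by tauto), mul_zero, mul_zero, add_zero, sub_zero]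
    simp_rw [cnt_lin]
    have h1 : ∀ a b : F, (if f0 * (a + b) + (F1 + F2) = 0 then (if f0 * (a * b) + (F2 + F3) * a + (F1 + F3) * b + g = 0 then q else 0) else 1)
      = 1 + (q * ind (f0 * a + F1 = 0) - 1) * ind (f0 * b + (f0 * a + (F1 + F2)) = 0) := by
      intro a b
      have e : f0 * b + (f0 * a + (F1 + F2)) = f0 * (a + b) + (F1 + F2) := by ring
      rw [e]
      split_ifs with hA hB
      · rw [ind_true hA, ind_true]
        · ring
        have : (f0 * a + F1) ^ 2 = 0 := by linear_combination (-f0) * hB + (F3 + f0 * a + F1) * hA + h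
        exact pow_eq_zero_iff (two_ne_zero) |>.1 this
      · rw [ind_true hA, ind_false]
        · ring
        intro h2
        apply hB
        have : f0 * (f0 * (a * b) + (F2 + F3) * a + (F1 + F3) * b + g) = 0 := by
          linear_combination (F3 + f0 * a + F1) * hA + h - (f0 * a + F1) * h2
        simpa [h0] using this
      · rw [ind_false hA]; simp
    simp_rw [h1, Finset.sum_add_distrib, ← Finset.mul_sum, cnt_lin, if_neg h0, mul_one, Finset.sum_sub_distrib,
      ← Finset.mul_sum, cnt_lin, if_neg h0]
    simp
    ring

lemma fib2 (f0 c : F) :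
    cnt (fun a : Fin 2 → F => (a 0 + a 1) * f0 - c = 0) =
    q * (1 - ind (f0 = 0)) + q ^ 2 * ind (f0 = 0 ∧ c = 0) := by
  classical
  rw [← cnt_equiv (e2 (F := F)).symm]
  unfold cnt
  rw [Fintype.sum_prod_type]
  have : ∀ a b : F, ind (((e2.symm (a, b) : Fin 2 → F) 0 + (e2.symm (a, b) : Fin 2 → F) 1) * f0 - c = 0)
    = ind (f0 * b + (f0 * a - c) = 0) := by
    intro a b
    congr 1
    have he : (e2.symm (a, b) : Fin 2 → F) = ![a, b] := rfl
    rw [he]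
    simp only [cons_val]
    congr! 1
    ring
  simp_rw [this, cnt_lin]
  by_cases h0 : f0 = 0
  · by_cases hc : c = 0
    · simp [h0, hc, ind]; ring
    · simp [h0, hc, ind]
  · simp [h0, ind]

lemma fib1 (f0 c : F) :
    cnt (fun a : Unit → F => a () * f0 - c = 0) =
    (1 - ind (f0 = 0)) + q * ind (f0 = 0 ∧ c = 0) := by
  classical
  rw [← cnt_equiv (Equiv.funUnique Unit F).symm]
  unfold cnt
  have : ∀ a : F, ind (((Equiv.funUnique Unit F).symm a : Unit → F) () * f0 - c = 0)
    = ind (f0 * a + (- c) = 0) := by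
    intro a
    congr 1
    simp
    ring_nf
  simp_rw [this, cnt_lin]
  by_cases h0 : f0 = 0
  · by_cases hc : c = 0
    · simp [h0, hc, ind]
    · simp [h0, hc, ind]
  · simp [h0, ind]
end counting
end PartC

section PartD
open MvPolynomial Matrix

section counting2
variable {F : Type*} [Field F] [Fintype F]
local notation "q" => (Fintype.card F : ℤ)
variable {R E : Type*} [Fintype R] [DecidableEq R] [Fintype E] [DecidableEq E]

lemma cnt_reindex {R' E' : Type*} [Fintype R'] [DecidableEq R'] [Fintype E'] [DecidableEq E']
    (B : Matrix R E ℤ) (f : R' ≃ R) (g : E' ≃ E) (s : E' → ℤ) (hs : ∀ e, s e * s e = 1) :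
    cnt (fun x : E → F => Phi B x = 0) =
    cnt (fun x : E' → F => Phi (Matrix.of fun r e => B (f r) (g e) * s e) x = 0) := by
  refine Eq.trans ?_ (cnt_equiv (Equiv.arrowCongr g.symm (Equiv.refl F)) (fun x : E' → F => Phi (Matrix.of fun r e => B (f r) (g e) * s e) x = 0))
  apply cnt_congr
  intro x
  rw [show ((Equiv.arrowCongr g.symm (Equiv.refl F)) x) = x ∘ g from rfl]
  have h := Phi_sign (B.submatrix f g) (x ∘ g) s hs
  rw [Phi_reindex] at h
  rw [← h]
  rfl

lemma Phi_char_dvd (p : ℕ) [Fact p.Prime] [CharP F p] (B : Matrix R E ℤ) (hR : 1 ≤ Fintype.card R) (hE : 1 ≤ Fintype.card E) :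
    (p : ℤ) ∣ cnt (fun x : E → F => Phi B x = 0) := by
  classical
  have h := char_dvd_card_solutions (K := F) p (f := PhiP F B) (by
    have := PhiP_degree F B
    omega)
  rw [cnt_eq_card, Int.natCast_dvd_natCast, Nat.card_eq_fintype_card]
  convert h using 4 with x
  rw [PhiP_hom, show (⇑(eval x) ∘ X) = x from by ext e; simp]

def Zprop (D : Matrix R R F) (u : Fin 3 → R → F) : Prop :=
  D.det = 0 ∧ Ff D u 0 1 2 = 0 ∧ Ff D u 1 0 2 = 0 ∧ Ff D u 2 0 1 = 0

lemma S3_count (B : Matrix (Unit ⊕ R) (Fin 3 ⊕ E) ℤ) (h1 : ∀ i, B (.inl ()) (.inl i) = 1)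
    (h0 : ∀ e, B (.inl ()) (.inr e) = 0) :
    ∃ Y : ℤ, cnt (fun x : Fin 3 ⊕ E → F => Phi B x = 0) = q ^ 2 * q ^ (Fintype.card E)
      - q ^ 2 * cnt (fun y : E → F => Zprop (Dm (B.submatrix .inr .inr) y)
          (fun i => Sum.elim 0 (fun r => (B (.inr r) (.inl i) : F)))) + q ^ 3 * Y := by
  set u : Fin 3 → E ⊕ R → F := (fun i => Sum.elim 0 (fun r => (B (.inr r) (.inl i) : F))) with hu
  refine ⟨cnt (fun y : E → F => Zprop (Dm (B.submatrix .inr .inr) y) u ∧ - T3 (Dm (B.submatrix .inr .inr) y) u 0 = 0), ?_⟩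
  rw [cnt_sum]
  have key : ∀ y : E → F, cnt (fun a : Fin 3 → F => Phi B (Sum.elim a y) = 0) =
      q ^ 2 - q ^ 2 * ind (Zprop (Dm (B.submatrix .inr .inr) y) u) +
       q ^ 3 * ind (Zprop (Dm (B.submatrix .inr .inr) y) u ∧ - T3 (Dm (B.submatrix .inr .inr) y) u 0 = 0) := by
    intro y
    set D := Dm (B.submatrix .inr .inr) y with hD
    have hsym : Dᵀ = D := Dm_symm _ _
    have hQ := (PQ3 D hsym u 0).2
    unfold Zprop
    rw [← fib3 (D.det) (Ff D u 0 1 2) (Ff D u 1 0 2) (Ff D u 2 0 1) (- T3 D u 0) (by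
      unfold Q3 at hQ; linear_combination - hQ)]
    apply cnt_congr
    intro a
    have hP := (PQ3 D hsym u a).1
    rw [Phi_S3 B h1 h0]
    rw [show ((Sum.elim a y ∘ Sum.inr : E → F)) = y from rfl, ← hD, ← hu,
      show ((Sum.elim a y ∘ Sum.inl : Fin 3 → F)) = a from rfl]
    unfold P3 at hP
    rw [← neg_eq_zero]
    constructor
    · intro h; rw [← h]; linear_combination hP
    · intro h; rw [← h]; linear_combination -hP
  simp_rw [key]
  rw [Finset.sum_add_distrib, Finset.sum_sub_distrib, ← Finset.mul_sum, ← Finset.mul_sum]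
  unfold cnt
  simp
  ring

lemma S2_count (B : Matrix (Unit ⊕ R) (Fin 2 ⊕ E) ℤ) (h1 : ∀ i, B (.inl ()) (.inl i) = 1)
    (h0 : ∀ e, B (.inl ()) (.inr e) = 0) :
    ∃ Y : ℤ, cnt (fun x : Fin 2 ⊕ E → F => Phi B x = 0) = q * q ^ (Fintype.card E)
      - q * cnt (fun y : E → F => Phi (B.submatrix .inr .inr) y = 0) + q ^ 2 * Y := by
  set u : E ⊕ R → F := Sum.elim 0 (fun r => (B (.inr r) (.inl 0) : F)) with hu
  set v : E ⊕ R → F := Sum.elim 0 (fun r => (B (.inr r) (.inl 1) : F)) with hv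
  refine ⟨cnt (fun y : E → F => Phi (B.submatrix .inr .inr) y = 0 ∧ adjq (Dm (B.submatrix .inr .inr) y) (u - v) (u - v) = 0), ?_⟩
  rw [cnt_sum]
  have key : ∀ y : E → F, cnt (fun a : Fin 2 → F => Phi B (Sum.elim a y) = 0) =
      q * (1 - ind (Phi (B.submatrix .inr .inr) y = 0)) +
       q ^ 2 * ind (Phi (B.submatrix .inr .inr) y = 0 ∧ adjq (Dm (B.submatrix .inr .inr) y) (u - v) (u - v) = 0) := by
    intro y
    rw [← fib2]
    apply cnt_congr
    intro a
    rw [Phi_S2 B h1 h0, T2_eq _ (Dm_symm _ _), neg_eq_zero]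
    rfl
  simp_rw [key]
  rw [Finset.sum_add_distrib, ← Finset.mul_sum, ← Finset.mul_sum, Finset.sum_sub_distrib]
  unfold cnt
  simp
  ring

lemma S1_count (B : Matrix R (Unit ⊕ E) ℤ) :
    cnt (fun x : Unit ⊕ E → F => Phi B x = 0) = q ^ (Fintype.card E)
      - cnt (fun y : E → F => Phi (B.submatrix id .inr) y = 0) + q * 
       cnt (fun y : E → F => Phi (B.submatrix id .inr) y = 0 ∧ adjq (Dm (B.submatrix id .inr) y) 
        (Sum.elim 0 (fun r => (B r (.inl ()) : F))) (Sum.elim 0 (fun r => (B r (.inl ()) : F))) = 0) := by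
  set u : E ⊕ R → F := Sum.elim 0 (fun r => (B r (.inl ()) : F)) with hu
  rw [cnt_sum]
  have key : ∀ y : E → F, cnt (fun a : Unit → F => Phi B (Sum.elim a y) = 0) =
      (1 - ind (Phi (B.submatrix id .inr) y = 0)) +
       q * ind (Phi (B.submatrix id .inr) y = 0 ∧ adjq (Dm (B.submatrix id .inr) y) u u = 0) := by
    intro y
    rw [← fib1]
    apply cnt_congr
    intro a
    rw [Phi_S1 B, T1_eq _ (Dm_symm _ _)]
    rfl
  simp_rw [key]
  rw [Finset.sum_add_distrib, ← Finset.mul_sum, Finset.sum_sub_distrib]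
  unfold cnt
  simp

/-- row `w` has exactly `k` nonzero entries, all signs -/
def RowS (B : Matrix R E ℤ) (w : R) (k : ℕ) : Prop :=
  ∃ c : Fin k ↪ E, (∀ i, B w (c i) * B w (c i) = 1) ∧ ∀ e, e ∉ Set.range c → B w e = 0

lemma row_normal (B : Matrix R E ℤ) (w : R) (k : ℕ) (h : RowS B w k) :
    ∃ (E' : Finset E) (B' : Matrix (Unit ⊕ {r // r ≠ w}) (Fin k ⊕ E') ℤ),
      (∀ i, B' (.inl ()) (.inl i) = 1) ∧ (∀ e, B' (.inl ()) (.inr e) = 0) ∧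
      k + E'.card = Fintype.card E ∧
      cnt (fun x : E → F => Phi B x = 0) = cnt (fun x : Fin k ⊕ E' → F => Phi B' x = 0) := by
  classical
  obtain ⟨c, hc1, hc0⟩ := h
  let E' : Finset E := Finset.univ.filter fun e => e ∉ Set.range c
  let f : Unit ⊕ {r // r ≠ w} ≃ R := Equiv.ofBijective (Sum.elim (fun _ => w) Subtype.val) (by
    constructor
    · rintro (a | a) (b | b) h
      · rfl
      · exact absurd h.symm b.2
      · exact absurd h a.2
      · exact congrArg _ (Subtype.ext h)
    · intro r
      by_cases h : r = w
      · exact ⟨.inl (), h.symm⟩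
      · exact ⟨.inr ⟨r, h⟩, rfl⟩)
  let g : Fin k ⊕ E' ≃ E := Equiv.ofBijective (Sum.elim c Subtype.val) (by
    constructor
    · rintro (a | a) (b | b) h
      · exact congrArg _ (c.injective h)
      · exact absurd ⟨a, h⟩ (Finset.mem_filter.1 b.2).2
      · exact absurd ⟨b, h.symm⟩ (Finset.mem_filter.1 a.2).2
      · exact congrArg _ (Subtype.ext h)
    · intro e
      by_cases h : e ∈ Set.range c
      · obtain ⟨i, hi⟩ := h
        exact ⟨.inl i, hi⟩
      · exact ⟨.inr ⟨e, by simpa [E'] using h⟩, rfl⟩)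
  let s : Fin k ⊕ E' → ℤ := Sum.elim (fun i => B w (c i)) 1
  refine ⟨E', Matrix.of fun r e => B (f r) (g e) * s e, ?_, ?_, ?_, ?_⟩
  · intro i; exact hc1 i
  · intro e
    have : B w e.1 = 0 := hc0 _ (Finset.mem_filter.1 e.2).2
    change B w e.1 * _ = 0
    rw [this, zero_mul]
  · have := Fintype.card_congr g
    simpa using this
  · apply cnt_reindex
    rintro (i | e)
    · exact hc1 i
    · rfl

lemma LemPQ (p : ℕ) [Fact p.Prime] [CharP F p] (B : Matrix R E ℤ) (w : R) (h : RowS B w 2 ∨ RowS B w 3)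
    (hR : 2 ≤ Fintype.card R) (hE : 3 ≤ Fintype.card E) :
    (p * q : ℤ) ∣ cnt (fun x : E → F => Phi B x = 0) := by
  have hpq : (p : ℤ) ∣ q := by
    have : ((Fintype.card F : ℕ) : F) = 0 := Nat.cast_card_eq_zero F
    rw [CharP.cast_eq_zero_iff F p] at this
    exact_mod_cast this
  have hpq2 : (p * q : ℤ) ∣ q ^ 2 := by rw [sq]; exact mul_dvd_mul_right hpq _
  rcases h with h | h
  · obtain ⟨E', B', h1, h0, hcard, hcnt⟩ := row_normal (F := F) B w 2 h
    obtain ⟨Y, hY⟩ := S2_count (F := F) B' h1 h0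
    rw [hcnt, hY]
    have hp := Phi_char_dvd (F := F) p (B'.submatrix .inr .inr) (by
      rw [Fintype.card_subtype_compl, Fintype.card_subtype_eq]; omega) (by rw [Fintype.card_coe]; omega)
    refine dvd_add (dvd_sub ?_ ?_) (Dvd.dvd.mul_right hpq2 _)
    · refine hpq2.trans ?_
      rw [← pow_succ']; apply pow_dvd_pow; rw [Fintype.card_coe]; omega
    · rw [mul_comm]; exact mul_dvd_mul_left _ hp
  · obtain ⟨E', B', h1, h0, hcard, hcnt⟩ := row_normal (F := F) B w 3 h
    obtain ⟨Y, hY⟩ := S3_count (F := F) B' h1 h0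
    rw [hcnt, hY]
    refine hpq2.trans ?_
    refine dvd_add (dvd_sub ?_ ?_) ?_
    · exact Dvd.intro _ rfl
    · exact Dvd.intro _ rfl
    · exact (pow_dvd_pow _ (by norm_num)).mul_right _

lemma adjq_single (D : Matrix (E ⊕ R) (E ⊕ R) F) (u v : R → ℤ) (a b : R) (i j : ℤ)
    (hu : u = Pi.single a i) (hv : v = Pi.single b j) :
    adjq D (Sum.elim 0 (fun r => (u r : F))) (Sum.elim 0 (fun r => (v r : F))) =
      (i * j : F) * D.adjugate (.inr a) (.inr b) := by
  have h : ∀ (a : R) (i : ℤ), (Sum.elim 0 (fun r => ((Pi.single a i : R → ℤ) r : F)) : E ⊕ R → F) =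
      Pi.single (.inr a) (i : F) := by
    intro a i
    ext (e | r)
    · simp
    · simp only [Sum.elim_inr, Pi.single_apply, Sum.inr.injEq]
      split_ifs <;> simp
  rw [hu, hv, h, h]
  unfold adjq
  simp
  ring

/-- Lemma T -/
lemma LemT (p : ℕ) [Fact p.Prime] [CharP F p] (M : Matrix R E ℤ) (a w : R) (haw : a ≠ w)
    (h : RowS M w 2 ∨ RowS M w 3) (hR : 2 ≤ Fintype.card R) (hE : 3 ≤ Fintype.card E) :
    (p : ℤ) ∣ cnt (fun y : E → F => Phi M y = 0 ∧ (Dm M y).adjugate (.inr a) (.inr a) = 0) := by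
  let B : Matrix R (Unit ⊕ E) ℤ := Matrix.of fun r e => Sum.elim (fun _ => (Pi.single a 1 : R → ℤ) r) (M r) e
  have hB : B.submatrix id .inr = M := rfl
  have hrow : ∀ k, RowS M w k → RowS B w k := by
    rintro k ⟨c, h1, h0⟩
    refine ⟨c.trans ⟨Sum.inr, Sum.inr_injective⟩, fun i => h1 i, ?_⟩
    rintro (e | e) he
    · simp [B, haw.symm]
    · exact h0 e (by rintro ⟨i, rfl⟩; exact he ⟨i, rfl⟩)
  have h1 := LemPQ (F := F) p M w h hR hE
  have h2 := LemPQ (F := F) p B w (h.imp (hrow 2) (hrow 3)) hR (by simp; omega)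
  rw [S1_count, hB] at h2
  have e : ∀ y : E → F, adjq (Dm M y) (Sum.elim 0 (fun r => (B r (.inl ()) : F))) (Sum.elim 0 (fun r => (B r (.inl ()) : F)))
     = (Dm M y).adjugate (.inr a) (.inr a) := by
    intro y
    exact (adjq_single (Dm M y) _ _ a a 1 1 rfl rfl).trans (by simp)
  simp_rw [e] at h2
  have hpq : (p : ℤ) ∣ q := by
    have : ((Fintype.card F : ℕ) : F) = 0 := Nat.cast_card_eq_zero F
    rw [CharP.cast_eq_zero_iff F p] at this
    exact_mod_cast this
  have hpq2 : (p * q : ℤ) ∣ q ^ Fintype.card E :=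
    (by rw [sq]; exact mul_dvd_mul_right hpq _ : (p * q : ℤ) ∣ q ^ 2).trans (pow_dvd_pow _ (by omega))
  have h3 := (dvd_add_right (dvd_sub hpq2 h1)).1 h2
  rw [mul_comm] at h3
  refine (mul_dvd_mul_iff_left ?_).1 h3
  exact_mod_cast Fintype.card_ne_zero

/-- Theorem A: B in the normal form for the 3-valent vertex -/
lemma ThmA (p : ℕ) [Fact p.Prime] [CharP F p] (B : Matrix (Unit ⊕ R) (Fin 3 ⊕ E) ℤ) (h1 : ∀ i, B (.inl ()) (.inl i) = 1)
    (h0 : ∀ e, B (.inl ()) (.inr e) = 0) (a b : R) (hab : a ≠ b) (i j : ℤ) (hi : i * i = 1) (hj : j * j = 1)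
    (hu0 : (fun r => B (.inr r) (.inl 0)) = Pi.single a i)
    (hu1 : (fun r => B (.inr r) (.inl 1)) = Pi.single b j)
    (hu2 : (fun r => B (.inr r) (.inl 2)) = 0)
    (hra : RowS (B.submatrix .inr .inr) a 2 ∨ RowS (B.submatrix .inr .inr) a 3)
    (hrb : RowS (B.submatrix .inr .inr) b 2 ∨ RowS (B.submatrix .inr .inr) b 3)
    (hR : 2 ≤ Fintype.card R) (hE : 3 ≤ Fintype.card E) :
    ∃ Y : ℤ, cnt (fun x : Fin 3 ⊕ E → F => Phi B x = 0) = 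
      q ^ 2 * (cnt (fun y : E → F => Phi (B.submatrix .inr .inr) y = 0 ∧ 
        (Dm (B.submatrix .inr .inr) y).adjugate (.inr a) (.inr b) = 0) + p * Y) := by
  obtain ⟨Y, hY⟩ := S3_count (F := F) B h1 h0
  set M := B.submatrix .inr .inr with hM
  obtain ⟨ta, hta⟩ := LemT (F := F) p M a b hab hrb hR hE
  obtain ⟨tb, htb⟩ := LemT (F := F) p M b a hab.symm hra hR hE
  have hpq : (p : ℤ) ∣ q := by
    have : ((Fintype.card F : ℕ) : F) = 0 := Nat.cast_card_eq_zero F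
    rw [CharP.cast_eq_zero_iff F p] at this
    exact_mod_cast this
  obtain ⟨m, hm⟩ := hpq
  have hZ : cnt (fun y : E → F => Zprop (Dm M y) (fun i => Sum.elim 0 (fun r => (B (.inr r) (.inl i) : F)))) =
     cnt (fun y : E → F => Phi M y = 0 ∧ (Dm M y).adjugate (.inr a) (.inr a) = 0) + 
     cnt (fun y : E → F => Phi M y = 0 ∧ (Dm M y).adjugate (.inr b) (.inr b) = 0) -
     cnt (fun y : E → F => Phi M y = 0 ∧ (Dm M y).adjugate (.inr a) (.inr b) = 0) := by
    unfold cnt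
    rw [← Finset.sum_add_distrib, ← Finset.sum_sub_distrib]
    refine Finset.sum_congr rfl fun y _ => ?_
    set u : Fin 3 → E ⊕ R → F := (fun i => Sum.elim 0 (fun r => (B (.inr r) (.inl i) : F))) with hu
    set D := Dm M y with hD
    have hsym : Dᵀ = D := Dm_symm _ _
    have hi' : (i * i : F) = 1 := by exact_mod_cast congrArg (Int.cast : ℤ → F) hi
    have hj' : (j * j : F) = 1 := by exact_mod_cast congrArg (Int.cast : ℤ → F) hj
    have hadj : D.adjugate (.inr b) (.inr a) = D.adjugate (.inr a) (.inr b) := by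
      conv_lhs => rw [← hsym]
      rw [← adjugate_transpose]; rfl
    have q00 : adjq D (u 0) (u 0) = D.adjugate (.inr a) (.inr a) := by
      rw [hu]; beta_reduce; rw [adjq_single D _ _ a a i i hu0 hu0, hi', one_mul]
    have q11 : adjq D (u 1) (u 1) = D.adjugate (.inr b) (.inr b) := by
      rw [hu]; beta_reduce; rw [adjq_single D _ _ b b j j hu1 hu1, hj', one_mul]
    have q01 : adjq D (u 0) (u 1) = (i * j) * D.adjugate (.inr a) (.inr b) := by
      rw [hu]; beta_reduce; rw [adjq_single D _ _ a b i j hu0 hu1]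
    have q10 : adjq D (u 1) (u 0) = (i * j) * D.adjugate (.inr a) (.inr b) := by
      rw [hu]; beta_reduce; rw [adjq_single D _ _ b a j i hu1 hu0, hadj, mul_comm (j : F)]
    have hu2' : u 2 = 0 := by
      rw [hu]; ext (e | r)
      · rfl
      · have := congrFun hu2 r
        simp at this
        simp [this]
    have sub1 : ∀ x y z, adjq D (x - y) z = adjq D x z - adjq D y z := by
      intro x y z; unfold adjq; rw [sub_dotProduct]
    have sub2 : ∀ x y z, adjq D x (y - z) = adjq D x y - adjq D x z := by
      intro x y z; unfold adjq; rw [mulVec_sub, dotProduct_sub]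
    have z1 : ∀ x, adjq D 0 x = 0 := by intro x; simp [adjq]
    have z2 : ∀ x, adjq D x 0 = 0 := by intro x; simp [adjq]
    have hQ := (PQ3 D hsym u 0).2
    unfold Zprop
    unfold Q3 at hQ
    have F1 : Ff D u 0 1 2 = - (adjq D (u 0) (u 0) - adjq D (u 0) (u 1)) := by
      unfold Ff; rw [hu2', sub_zero, sub1, q10, q01]
    have F2 : Ff D u 1 0 2 = - (adjq D (u 1) (u 1) - adjq D (u 0) (u 1)) := by
      unfold Ff; rw [hu2', sub_zero, sub1, q01]
    have F3 : Ff D u 2 0 1 = - adjq D (u 0) (u 1) := by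
      unfold Ff; rw [hu2', zero_sub, zero_sub]; unfold adjq; rw [mulVec_neg, dotProduct_neg, neg_dotProduct, neg_neg]
    beta_reduce
    rw [← hD]
    rw [F1, F2, F3] at hQ ⊢
    have hN : D.adjugate (.inr a) (.inr b) = 0 ↔ adjq D (u 0) (u 1) = 0 := by
      rw [q01]
      have : (i * j : F) ≠ 0 := by
        intro h
        have : (1 : F) = 0 := by rw [← mul_one (1:F)]; nth_rewrite 1 [← hi']; rw [← hj']; linear_combination (i * j : F) * h
        exact one_ne_zero this
      simp [this]
    rw [hN, ← q00, ← q11]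
    generalize adjq D (u 0) (u 0) = A at *
    generalize adjq D (u 1) (u 1) = C' at *
    generalize adjq D (u 0) (u 1) = N at *
    unfold Phi
    try rw [← hD]
    by_cases hd : D.det = 0
    · rw [hd] at hQ ⊢
      have hQ' : A * C' = N * N := by linear_combination hQ
      simp only [true_and]
      by_cases hN0 : N = 0
      · subst hN0
        simp only [mul_zero, mul_eq_zero] at hQ'
        by_cases hA : A = 0 <;> by_cases hC : C' = 0 <;> simp [ind, hA, hC]
        simp [hA, hC] at hQ'
      · have hA : A ≠ 0 := by rintro rfl; simp at hQ'; tauto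
        have hC : C' ≠ 0 := by rintro rfl; simp at hQ'; tauto
        simp [ind, hA, hC, hN0]
    · simp [ind, hd]
  rw [hY, hZ, hta, htb]
  refine ⟨m * q ^ (Fintype.card E - 1) - ta - tb + m * Y, ?_⟩
  have : q ^ Fintype.card E = q * q ^ (Fintype.card E - 1) := by
    rw [← pow_succ']; congr 1; omega
  rw [this, pow_succ q 2]
  linear_combination (q ^ 2 * q ^ (Fintype.card E - 1) + q ^ 2 * Y) * hm
end counting2
end PartD

section PartG5
open MvPolynomial Matrix

section coefs
variable {E : Type*} [Fintype E] [DecidableEq E]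

noncomputable def cst (E : Type*) [Fintype E] (m : ℕ) : E →₀ ℕ := Finsupp.equivFunOnFinite.symm (fun _ => m)

lemma cst_apply (m : ℕ) (e : E) : cst E m e = m := rfl

lemma eq_cst_of_le {m : ℕ} {d : E →₀ ℕ} (h1 : ∀ e, m ≤ d e) (h2 : d.sum (fun _ e => e) ≤ m * Fintype.card E) :
    d = cst E m := by
  rw [Finsupp.sum_fintype _ _ (by simp)] at h2
  have h3 : ∑ e : E, m = m * Fintype.card E := by simp [mul_comm]
  have h4 : ∑ e : E, m = ∑ e, d e := le_antisymm (Finset.sum_le_sum fun e _ => h1 e) (h3 ▸ h2)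
  ext e
  have := (Finset.sum_eq_sum_iff_of_le (fun e _ => h1 e)).1 h4 e (Finset.mem_univ e)
  rw [cst_apply, this]

lemma coeff_pow_lemma (p : ℕ) [Fact p.Prime] (P : MvPolynomial E (ZMod p)) (hP : P.totalDegree ≤ Fintype.card E) (s : ℕ) :
    coeff (cst E (p ^ s - 1)) (P ^ (p ^ s - 1)) = (coeff (cst E (p - 1)) (P ^ (p - 1))) ^ s := by
  have hp1 : 1 ≤ p := (Fact.out : p.Prime).one_lt.le
  induction s with
  | zero => 
    simp only [pow_zero, Nat.sub_self]
    have : cst E 0 = 0 := by ext; rfl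
    rw [this]; simp
  | succ s ih =>
    have hs1 : 1 ≤ p ^ s := Nat.one_le_pow _ _ hp1
    have e1 : p ^ (s + 1) - 1 = (p ^ s - 1) * p + (p - 1) := by
      rw [pow_succ, Nat.sub_mul]
      have : p ≤ p ^ s * p := Nat.le_mul_of_pos_left _ hs1
      omega
    rw [pow_succ (coeff _ _) s, ← ih, e1, pow_add P, pow_mul, ← expand_zmod, coeff_mul]
    rw [Finset.sum_eq_single (p • cst E (p ^ s - 1), cst E (p - 1))]
    · rw [coeff_expand_smul _ (by omega)]
    · rintro ⟨m1, m2⟩ hm hne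
      rw [Finset.HasAntidiagonal.mem_antidiagonal] at hm
      by_contra hnz
      have hz1 := left_ne_zero_of_mul hnz
      have hz2 := right_ne_zero_of_mul hnz
      simp only at hm hz1 hz2
      have hdvd : ∀ e, p ∣ m1 e := by
        intro e; by_contra h; exact hz1 (coeff_expand_of_not_dvd _ h)
      have hsum : ∀ e, m1 e + m2 e = (p ^ s - 1) * p + (p - 1) := fun e => by
        have := DFunLike.congr_fun hm e
        simpa [cst_apply] using this
      have h2 : m2 = cst E (p - 1) := by
        apply eq_cst_of_le
        · intro e
          obtain ⟨k, hk⟩ := hdvd e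
          have h3 := hsum e
          have h4 : p ∣ m2 e + 1 := by
            have : p ∣ m1 e + (m2 e + 1) := ⟨p ^ s - 1 + 1, by rw [← add_assoc, h3]; rw [mul_add, mul_one, mul_comm]; omega⟩
            exact (Nat.dvd_add_right (hdvd e)).1 this
          have := Nat.le_of_dvd (by omega) h4
          omega
        · refine (le_totalDegree (mem_support_iff.2 hz2)).trans ((totalDegree_pow _ _).trans ?_)
          exact Nat.mul_le_mul_left _ hP
      apply hne
      rw [h2]
      congr 1
      ext e
      have := hsum e
      rw [h2, cst_apply] at this
      simp only [Finsupp.smul_apply, cst_apply, smul_eq_mul]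
      rw [mul_comm p]; omega
    · intro h
      exfalso; apply h
      rw [Finset.HasAntidiagonal.mem_antidiagonal]
      ext e
      simp [cst_apply, mul_comm]

variable {F : Type*} [Field F] [Fintype F]

lemma totalDegree_map_le' {k k' : Type*} [CommRing k] [CommRing k'] (f : k →+* k') (P : MvPolynomial E k) :
    (map f P).totalDegree ≤ P.totalDegree := by
  unfold totalDegree
  exact Finset.sup_mono (support_map_subset f P)

lemma sum_pow_card_sub : ∑ x : F, x ^ (Fintype.card F - 1) = -1 := by
  classical
  have hc : 1 < Fintype.card F := Fintype.one_lt_card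
  have : ∀ x : F, x ^ (Fintype.card F - 1) = 1 - if x = 0 then 1 else 0 := by
    intro x
    split_ifs with h
    · rw [h, zero_pow (by omega)]; simp
    · rw [FiniteField.pow_card_sub_one_eq_one x h]; simp
  simp_rw [this]
  simp

lemma sum_eval_top (P : MvPolynomial E F) (hP : P.totalDegree ≤ (Fintype.card F - 1) * Fintype.card E) :
    ∑ x : E → F, eval x P = (-1) ^ Fintype.card E * coeff (cst E (Fintype.card F - 1)) P := by
  simp_rw [eval_eq']
  rw [Finset.sum_comm]
  simp_rw [← Finset.mul_sum]
  have key : ∀ d : E →₀ ℕ, ∑ x : E → F, ∏ i, x i ^ d i = ∏ i, ∑ t : F, t ^ d i := by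
    intro d
    rw [Finset.prod_univ_sum, Fintype.piFinset_univ]
  simp_rw [key]
  have hz : ∀ d ∈ P.support, d ≠ cst E (Fintype.card F - 1) → coeff d P * ∏ i, ∑ t : F, t ^ d i = 0 := by
    intro d hd hne
    have : ∃ i, d i < Fintype.card F - 1 := by
      by_contra hcon
      push Not at hcon
      exact hne (eq_cst_of_le hcon ((le_totalDegree hd).trans hP))
    obtain ⟨i, hi⟩ := this
    rw [Finset.prod_eq_zero (Finset.mem_univ i) (FiniteField.sum_pow_lt_card_sub_one F _ hi), mul_zero]
  rw [Finset.sum_eq_single (cst E (Fintype.card F - 1)) hz]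
  · simp_rw [cst_apply, sum_pow_card_sub]
    simp [mul_comm]
  · intro h; rw [notMem_support_iff.1 h, zero_mul]

variable {R : Type*} [Fintype R] [DecidableEq R]

lemma ThmB (p s : ℕ) [Fact p.Prime] [Algebra (ZMod p) F] (hF : Fintype.card F = p ^ s)
    (M : Matrix R E ℤ) (a b : R) (hE : Fintype.card E + 1 = 2 * Fintype.card R) (hR : 2 ≤ Fintype.card R) :
    ((cnt (fun y : E → F => Phi M y = 0 ∧ (Dm M y).adjugate (.inr a) (.inr b) = 0) : ℤ) : ZMod p) =
     - (coeff (cst E (p - 1)) ((PhiP (ZMod p) M * AdjP (ZMod p) M a b) ^ (p - 1))) ^ s := by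
  classical
  have hc : 1 < Fintype.card F := Fintype.one_lt_card
  set P := PhiP (ZMod p) M with hP
  set N := AdjP (ZMod p) M a b with hN
  have dP : P.totalDegree ≤ Fintype.card E - Fintype.card R := PhiP_degree _ _
  have dN : N.totalDegree ≤ Fintype.card E + 1 - Fintype.card R := AdjP_degree _ _ _ _
  have dPN : (P * N).totalDegree ≤ Fintype.card E := (totalDegree_mul _ _).trans (by omega)
  rw [← coeff_pow_lemma p _ dPN]
  apply (algebraMap (ZMod p) F).injective
  rw [map_intCast, map_neg]
  set ι := algebraMap (ZMod p) F with hι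
  have hev : ∀ x : E → F, (eval x (map ι P) = Phi M x ∧ eval x (map ι N) = (Dm M x).adjugate (.inr a) (.inr b)) := by
    intro x
    have h1 : ((eval x).comp (map ι)) ∘ (X : E → MvPolynomial E (ZMod p)) = x := by ext e; simp
    constructor
    · have := PhiP_hom ((eval x).comp (map ι)) M
      rw [h1] at this; exact this
    · have := AdjP_hom ((eval x).comp (map ι)) M a b
      rw [h1] at this; exact this
  have hq : ∀ t : F, ((ind (t = 0) : ℤ) : F) = 1 - t ^ (Fintype.card F - 1) := by
    intro t
    unfold ind
    split_ifs with h
    · rw [h, zero_pow (by omega)]; simp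
    · rw [FiniteField.pow_card_sub_one_eq_one t h]; simp
  have hind : ∀ P Q : Prop, ind (P ∧ Q) = ind P * ind Q := by
    intro P Q; unfold ind; split_ifs <;> simp_all
  unfold cnt
  push_cast
  simp_rw [hind]
  push_cast
  simp_rw [hq, ← fun x => (hev x).1, ← fun x => (hev x).2]
  set P' := map ι P
  set N' := map ι N
  set Q := Fintype.card F - 1 with hQ
  have hQ1 : 1 ≤ Q := by omega
  have dP' : P'.totalDegree ≤ Fintype.card E - Fintype.card R := (totalDegree_map_le' _ _).trans dP
  have dN' : N'.totalDegree ≤ Fintype.card E + 1 - Fintype.card R := (totalDegree_map_le' _ _).trans dN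
  have dPN' : (P' * N').totalDegree ≤ Fintype.card E := (totalDegree_mul _ _).trans (by omega)
  have s1 : ∑ x : E → F, eval x (P' ^ Q) = 0 := by
    apply sum_eval_eq_zero
    refine lt_of_le_of_lt (totalDegree_pow _ _) ?_
    exact Nat.mul_lt_mul_of_pos_left (by omega) (by omega)
  have s2 : ∑ x : E → F, eval x (N' ^ Q) = 0 := by
    apply sum_eval_eq_zero
    refine lt_of_le_of_lt (totalDegree_pow _ _) ?_
    exact Nat.mul_lt_mul_of_pos_left (by omega) (by omega)
  have s0 : ∑ x : E → F, eval x (1 : MvPolynomial E F) = 0 := by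
    apply sum_eval_eq_zero
    rw [totalDegree_one]
    exact Nat.mul_pos (by omega) (by omega)
  have s3 := sum_eval_top ((P' * N') ^ Q) ((totalDegree_pow _ _).trans (Nat.mul_le_mul_left _ dPN'))
  have hodd : Odd (Fintype.card E) := ⟨Fintype.card R - 1, by omega⟩
  have expd : ∀ x : E → F, (1 - eval x P' ^ Q) * (1 - eval x N' ^ Q) = 
    eval x 1 - eval x (P' ^ Q) - eval x (N' ^ Q) + eval x ((P' * N') ^ Q) := by
    intro x; simp; ring
  simp_rw [expd]
  rw [Finset.sum_add_distrib, Finset.sum_sub_distrib, Finset.sum_sub_distrib, s0, s1, s2, s3, hodd.neg_one_pow]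
  rw [← hQ, ← coeff_map, map_pow, map_mul, hQ, hF]
  ring
end coefs
end PartG5

section PartH
open MvPolynomial Matrix

section cb
variable {R E : Type*} [Fintype R] [DecidableEq R] [Fintype E] [DecidableEq E]

lemma det_mul_expand {A : Type*} [CommRing A] (P : Matrix R E A) (Q : Matrix E R A) :
    (P * Q).det = ∑ f : R → E, (∏ i, Q (f i) i) * (P.submatrix id f).det := by
  rw [← det_transpose]
  have h1 : (P * Q)ᵀ = fun i => ∑ e, Q e i • Pᵀ e := by
    ext i j
    simp [mul_apply, mul_comm]
  rw [h1]
  have h2 := (detRowAlternating (n := R) (R := A)).toMultilinearMap.map_sum (fun (i : R) (e : E) => Q e i • Pᵀ e)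
  refine (h2.trans ?_)
  refine Finset.sum_congr rfl fun f _ => ?_
  have h3 := (detRowAlternating (n := R) (R := A)).toMultilinearMap.map_smul_univ (fun i => Q (f i) i) (fun i => Pᵀ (f i))
  refine h3.trans ?_
  rw [smul_eq_mul, ← det_transpose (P.submatrix id f)]
  rfl

lemma cauchyBinet {A : Type*} [CommRing A] (P : Matrix R E A) (y : E → A) (d : Finset E → A)
    (hd : ∀ (S : Finset E) (g : R ≃ S), (P.submatrix id (fun i => (g i : E))).det ^ 2 = d S) :
    (P * diagonal y * Pᵀ).det = ∑ S ∈ Finset.univ.powersetCard (Fintype.card R), d S * ∏ e ∈ S, y e := by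
  classical
  rw [Matrix.mul_assoc, det_mul_expand]
  have h1 : ∑ f : R → E, (∏ i, (diagonal y * Pᵀ) (f i) i) * (P.submatrix id f).det =
    ∑ f ∈ Finset.univ.filter (fun f : R → E => Function.Injective f), (∏ i, (diagonal y * Pᵀ) (f i) i) * (P.submatrix id f).det := by
    symm
    apply Finset.sum_subset (Finset.subset_univ _)
    intro f _ hf
    have : ¬ Function.Injective f := by simpa using hf
    rw [Function.Injective] at this
    push Not at this
    obtain ⟨i, j, hij, hne⟩ := this
    rw [det_zero_of_column_eq hne (fun k => by simp [hij]), mul_zero]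
  rw [h1]
  rw [← Finset.sum_fiberwise_of_maps_to (s := Finset.univ.filter (fun f : R → E => Function.Injective f))
    (t := Finset.univ.powersetCard (Fintype.card R)) (g := fun f => Finset.univ.image f)]
  · refine Finset.sum_congr rfl fun S hS => ?_
    rw [Finset.mem_powersetCard_univ] at hS
    have hcard : Fintype.card R = Fintype.card S := by rw [Fintype.card_coe, hS]
    let g : R ≃ S := Fintype.equivOfCardEq hcard
    have hre : ∀ σ : Equiv.Perm R, (∏ i, (diagonal y * Pᵀ) (g (σ i) : E) i) * (P.submatrix id (fun i => (g (σ i) : E))).det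
       = (∏ e ∈ S, y e) * (P.submatrix id (fun i => (g i : E))).det * ((σ.sign : ℤ) * ∏ i, P i (g (σ i) : E)) := by
      intro σ
      have e1 : (P.submatrix id (fun i => (g (σ i) : E))) = (P.submatrix id (fun i => (g i : E))).submatrix id σ := rfl
      rw [e1, det_permute']
      simp_rw [diagonal_mul, transpose_apply]
      rw [Finset.prod_mul_distrib]
      have e2 : ∏ i, y (g (σ i) : E) = ∏ e ∈ S, y e := by
        rw [← Finset.prod_coe_sort S, ← Equiv.prod_comp (σ.trans g)]
        rfl
      rw [e2]
      ring
    have hsum : ∑ f ∈ (Finset.univ.filter (fun f : R → E => Function.Injective f)).filter (fun f => Finset.univ.image f = S),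
        (∏ i, (diagonal y * Pᵀ) (f i) i) * (P.submatrix id f).det = 
        ∑ σ : Equiv.Perm R, (∏ i, (diagonal y * Pᵀ) (g (σ i) : E) i) * (P.submatrix id (fun i => (g (σ i) : E))).det := by
      symm
      refine Finset.sum_bij (fun σ _ => fun i => (g (σ i) : E)) ?_ ?_ ?_ ?_
      · intro σ _
        rw [Finset.mem_filter, Finset.mem_filter]
        refine ⟨⟨Finset.mem_univ _, fun i j h => σ.injective (g.injective (Subtype.ext h))⟩, ?_⟩
        ext e
        simp only [Finset.mem_image, Finset.mem_univ, true_and]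
        constructor
        · rintro ⟨i, rfl⟩; exact (g (σ i)).2
        · intro he; exact ⟨σ.symm (g.symm ⟨e, he⟩), by simp⟩
      · intro σ _ τ _ h
        ext i
        exact g.injective (Subtype.ext (congrFun h i))
      · intro f hf
        rw [Finset.mem_filter, Finset.mem_filter] at hf
        obtain ⟨⟨_, hinj⟩, him⟩ := hf
        have hm : ∀ i, f i ∈ S := fun i => by rw [← him]; exact Finset.mem_image_of_mem _ (Finset.mem_univ i)
        let k : R → R := fun i => g.symm ⟨f i, hm i⟩
        have hk : Function.Injective k := fun i j h => hinj (congrArg Subtype.val (g.symm.injective h))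
        refine ⟨Equiv.ofBijective k (Finite.injective_iff_bijective.1 hk), Finset.mem_univ _, ?_⟩
        funext i
        simp [k]
      · intro σ _; rfl
    rw [hsum]
    simp_rw [hre]
    rw [← Finset.mul_sum, ← hd S g]
    have : (P.submatrix id (fun i => (g i : E))).det = ∑ σ : Equiv.Perm R, ((σ.sign : ℤ) * ∏ i, P i (g (σ i) : E) : A) := by
      rw [← det_transpose, det_apply']
      rfl
    rw [← this]
    ring
  · intro f hf
    rw [Finset.mem_filter] at hf
    rw [Finset.mem_powersetCard_univ, Finset.card_image_of_injective _ hf.2, Finset.card_univ]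

lemma Phi_expand {A : Type*} [CommRing A] (B : Matrix R E ℤ) (d : Finset E → ℤ)
    (hd : ∀ (S : Finset E) (g : R ≃ S), (B.submatrix id (fun i => (g i : E))).det ^ 2 = d S) (x : E → A) :
    Phi B x = (-1) ^ Fintype.card R * ∑ S ∈ Finset.univ.powersetCard (Fintype.card R), (d S : A) * ∏ e ∈ Sᶜ, x e := by
  -- generic version
  have hgen : PhiP ℤ B = (-1) ^ Fintype.card R *
      ∑ S ∈ Finset.univ.powersetCard (Fintype.card R), (d S : MvPolynomial E ℤ) * ∏ e ∈ Sᶜ, X e := by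
    let K := FractionRing (MvPolynomial E ℤ)
    let ι : MvPolynomial E ℤ →+* K := algebraMap _ _
    have hinj : Function.Injective ι := IsFractionRing.injective _ _
    apply hinj
    rw [PhiP_hom]
    set z : E → K := ι ∘ X with hz
    have hz0 : ∀ e, z e ≠ 0 := fun e h => X_ne_zero (R := ℤ) e (hinj (by rw [map_zero]; exact h))
    have hdz : IsUnit (diagonal z).det := by
      rw [det_diagonal]; exact (Finset.prod_ne_zero_iff.2 fun e _ => hz0 e).isUnit
    haveI : Invertible (diagonal z) := invertibleOfIsUnitDet _ hdz
    have hinv : ⅟(diagonal z) = diagonal (fun e => (z e)⁻¹) := by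
      rw [invOf_eq_nonsing_inv]
      apply inv_eq_right_inv
      rw [diagonal_mul_diagonal, ← diagonal_one]
      congr 1; ext e; exact mul_inv_cancel₀ (hz0 e)
    unfold Phi Dm
    rw [det_fromBlocks₁₁, hinv, zero_sub, det_neg, det_diagonal]
    rw [cauchyBinet (B.map (Int.cast : ℤ → K)) _ (fun S => (d S : K))]
    · rw [map_mul, map_pow, map_neg, map_one, map_sum, ← mul_assoc, mul_comm (∏ e, z e), mul_assoc, Finset.mul_sum]
      congr 1
      refine Finset.sum_congr rfl fun S _ => ?_
      rw [map_mul, map_intCast, map_prod, mul_left_comm]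
      congr 1
      rw [← Finset.prod_mul_prod_compl S, mul_right_comm, ← Finset.prod_mul_distrib]
      rw [Finset.prod_congr rfl (fun e _ => mul_inv_cancel₀ (hz0 e))]
      simp [hz]
    · intro S g
      rw [← hd S g]
      push_cast
      congr 1
      exact (Int.cast_det (R := K) (B.submatrix id (fun i => (g i : E)))).symm
  have h2 := congrArg (eval₂Hom (Int.castRingHom A) x) hgen
  rw [PhiP_hom] at h2
  have h3 : (eval₂Hom (Int.castRingHom A) x) ∘ (X : E → MvPolynomial E ℤ) = x := by ext e; simp
  rw [h3] at h2
  rw [h2]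
  simp only [map_mul, map_pow, map_neg, map_one, map_sum, map_intCast, map_prod, coe_eval₂Hom, eval₂_X]
end cb

section tree
variable {V : Type} [Fintype V] [DecidableEq V]

/-- incidence matrix -/
def Inc {ι : Type*} (c : V) (t h : ι → V) : Matrix {u : V // u ≠ c} ι ℤ :=
  Matrix.of fun u e => (if (u : V) = t e then 1 else 0) - (if (u : V) = h e then 1 else 0)

lemma inc_det {ι : Type*} [Fintype ι] [DecidableEq ι] (c : V) (t h : ι → V) (H : SimpleGraph V)
    (hH : ∀ u v, H.Adj u v → ∃ e, s(t e, h e) = s(u, v)) (hH' : ∀ e, H.Adj (t e) (h e)) (g : {u : V // u ≠ c} ≃ ι) [Decidable H.Connected] :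
    ((Inc c t h).submatrix id g).det ^ 2 = if H.Connected then 1 else 0 := by
  classical
  split_ifs with hcon
  · have key : ∀ v : V, ∃ z : ι → ℤ, ∀ r : {u : V // u ≠ c}, ∑ e, Inc c t h r e * z e = if (r : V) = v then 1 else 0 := by
      intro v
      have hr := hcon.preconnected c v
      rw [SimpleGraph.reachable_iff_reflTransGen] at hr
      induction hr with
      | refl => exact ⟨0, fun r => by simp [r.2]⟩
      | tail _ hadj ih =>
        rename_i v w _
        obtain ⟨z, hz⟩ := ih
        obtain ⟨e, he⟩ := hH _ _ hadj
        rw [Sym2.eq_iff] at he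
        rcases he with ⟨h1, h2⟩ | ⟨h1, h2⟩
        · refine ⟨z - Pi.single e 1, fun r => ?_⟩
          simp only [Pi.sub_apply, mul_sub, Finset.sum_sub_distrib, hz]
          simp [Pi.single_apply, Inc, h1, h2]
        · refine ⟨z + Pi.single e 1, fun r => ?_⟩
          simp only [Pi.add_apply, mul_add, Finset.sum_add_distrib, hz]
          simp [Pi.single_apply, Inc, h1, h2]
    choose z hz using key
    let P : Matrix {u : V // u ≠ c} {u : V // u ≠ c} ℤ := Matrix.of fun i r => z r (g i)
    have hP : ((Inc c t h).submatrix id g) * P = 1 := by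
      ext r r'
      rw [mul_apply]
      have := hz r' r
      rw [← Equiv.sum_comp g] at this
      refine this.trans ?_
      rw [one_apply]
      simp [Subtype.ext_iff]
    have hu : IsUnit ((Inc c t h).submatrix id g).det := by
      apply IsUnit.of_mul_eq_one P.det
      rw [← det_mul, hP, det_one]
    rcases Int.isUnit_iff.1 hu with h | h <;> rw [h] <;> norm_num
  · haveI : Nonempty V := ⟨c⟩
    have : ∃ v, ¬ H.Reachable c v := by
      by_contra hn
      push Not at hn
      exact hcon ((SimpleGraph.connected_iff_exists_forall_reachable _).2 ⟨c, hn⟩)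
    obtain ⟨v, hv⟩ := this
    have hvc : v ≠ c := by rintro rfl; exact hv (SimpleGraph.Reachable.refl _)
    rw [pow_eq_zero_iff two_ne_zero]
    rw [← exists_vecMul_eq_zero_iff]
    let Y : V → ℤ := fun u => if H.Reachable c u then 0 else 1
    have hY : ∀ w : V, ∑ r : {u : V // u ≠ c}, Y r * (if (r : V) = w then 1 else 0) = Y w := by
      intro w
      by_cases hw : w = c
      · subst hw
        rw [Finset.sum_eq_zero]
        · simp [Y]
        · intro r _; simp [r.2]
      · rw [Finset.sum_eq_single ⟨w, hw⟩]
        · simp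
        · intro r _ hr
          have : (r : V) ≠ w := fun h => hr (Subtype.ext h)
          simp [this]
        · simp
    refine ⟨fun r => Y r, ?_, ?_⟩
    · intro h0
      have := congrFun h0 ⟨v, hvc⟩
      simp [Y, hv] at this
    · ext i
      simp only [vecMul, dotProduct, submatrix_apply, id, Inc, of_apply, mul_sub, Finset.sum_sub_distrib, hY, Pi.zero_apply]
      have hadj := hH' (g i)
      have : H.Reachable c (t (g i)) ↔ H.Reachable c (h (g i)) :=
        ⟨fun h => h.trans hadj.reachable, fun h => h.trans hadj.symm.reachable⟩
      simp [Y, this]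

lemma kirchhoff_zero_iff' (G : SimpleGraph V) [DecidableRel G.Adj] (c : V) (t h : ↥G.edgeFinset → V) (hth : ∀ e, s(t e, h e) = (e : Sym2 V))
    {A : Type*} [CommRing A] (x : ↥G.edgeFinset → A) :
    aeval x (kirchhoff G) = 0 ↔ Phi (Inc c t h) x = 0 := by
  classical
  have hRc : Fintype.card {u : V // u ≠ c} + 1 = Fintype.card V := by
    rw [Fintype.card_subtype_compl, Fintype.card_subtype_eq]
    have : 0 < Fintype.card V := Fintype.card_pos_iff.2 ⟨c⟩
    omega
  let m : Finset ↥G.edgeFinset → Finset (Sym2 V) := fun S => S.map (Function.Embedding.subtype _)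
  have hm : ∀ (S : Finset ↥G.edgeFinset) (e : ↥G.edgeFinset), (e : Sym2 V) ∈ m S ↔ e ∈ S := by
    intro S e; simp [m]
  have hadj : ∀ (S : Finset ↥G.edgeFinset) u v, (SimpleGraph.fromEdgeSet (m S : Set (Sym2 V))).Adj u v ↔ ∃ e ∈ S, s(t e, h e) = s(u, v) := by
    intro S u v
    rw [SimpleGraph.fromEdgeSet_adj]
    constructor
    · rintro ⟨h1, _⟩
      have h1' : s(u, v) ∈ m S := h1
      simp only [m, Finset.mem_map] at h1'
      obtain ⟨e, he, he'⟩ := h1'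
      exact ⟨e, he, by rw [hth]; exact he'⟩
    · rintro ⟨e, he, he'⟩
      rw [hth] at he'
      have : s(u, v) ∈ G.edgeFinset := he' ▸ e.2
      rw [SimpleGraph.mem_edgeFinset, SimpleGraph.mem_edgeSet] at this
      refine ⟨?_, this.ne⟩
      rw [← he']
      exact (hm S e).2 he
  have hedge : ∀ S : Finset ↥G.edgeFinset, (SimpleGraph.fromEdgeSet (m S : Set (Sym2 V))).edgeSet = m S := by
    intro S
    rw [SimpleGraph.edgeSet_fromEdgeSet]
    rw [sdiff_eq_left, Set.disjoint_left]
    intro e he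
    simp only [m, Finset.coe_map, Set.mem_image] at he
    obtain ⟨e', _, rfl⟩ := he
    exact SimpleGraph.not_isDiag_of_mem_edgeSet G (SimpleGraph.mem_edgeFinset.1 e'.2)
  have hcardm : ∀ S, (m S).card = S.card := fun S => Finset.card_map _
  have htree : ∀ S : Finset ↥G.edgeFinset, (SimpleGraph.fromEdgeSet (m S : Set (Sym2 V))).IsTree ↔ 
      (SimpleGraph.fromEdgeSet (m S : Set (Sym2 V))).Connected ∧ S.card = Fintype.card {u : V // u ≠ c} := by
    intro S
    rw [SimpleGraph.isTree_iff_connected_and_card, hedge]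
    refine and_congr_right fun _ => ?_
    have : Nat.card ((m S : Finset (Sym2 V)) : Set (Sym2 V)) = S.card := by
      rw [← hcardm]; simp
    rw [this, Nat.card_eq_fintype_card]
    omega
  have hPhi := Phi_expand (A := A) (Inc c t h) (fun S => if (SimpleGraph.fromEdgeSet (m S : Set (Sym2 V))).Connected then 1 else 0) (by
    intro S g
    refine inc_det c (fun e : S => t e) (fun e : S => h e) _ ?_ ?_ g
    · intro u v huv
      obtain ⟨e, he, he'⟩ := (hadj S u v).1 huv
      exact ⟨⟨e, he⟩, he'⟩
    · intro e
      exact (hadj S _ _).2 ⟨e, e.2, rfl⟩) x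
  have hKx : aeval x (kirchhoff G) = ∑ S ∈ Finset.univ.powersetCard (Fintype.card {u : V // u ≠ c}),
      (((if (SimpleGraph.fromEdgeSet (m S : Set (Sym2 V))).Connected then 1 else 0 : ℤ)) : A) * ∏ e ∈ Sᶜ, x e := by
    have hdo : ∀ (I : Finset (Finset (Sym2 V))) (T : Set (Sym2 V)),
        T ∈ (do let a ← I; pure (a : Set (Sym2 V)) : Finset (Set (Sym2 V))) ↔ ∃ a ∈ I, T = a := by
      intro I T
      simp [eq_comm]
    unfold kirchhoff
    rw [map_sum]
    simp only [Int.cast_ite, Int.cast_one, Int.cast_zero, ite_mul, one_mul, zero_mul]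
    rw [← Finset.sum_filter]
    symm
    refine Finset.sum_bij (fun S _ => (m S : Set (Sym2 V))) ?_ ?_ ?_ ?_
    · intro S hS
      rw [Finset.mem_filter, Finset.mem_powersetCard_univ] at hS
      rw [Finset.mem_filter, hdo]
      refine ⟨⟨m S, ?_, rfl⟩, ?_⟩
      · rw [Finset.mem_powerset]
        intro e he
        simp only [m, Finset.mem_map] at he
        obtain ⟨e', _, rfl⟩ := he
        exact e'.2
      · exact (htree S).2 ⟨hS.2, hS.1⟩
    · intro S _ S' _ hSS
      exact Finset.map_injective _ (Finset.coe_injective hSS)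
    · intro T hT
      rw [Finset.mem_filter, hdo] at hT
      obtain ⟨⟨T, hTG, rfl⟩, hT2⟩ := hT
      rw [Finset.mem_powerset] at hTG
      have hT' : m (Finset.univ.filter fun e => (e : Sym2 V) ∈ T) = T := by
        ext e
        simp only [m, Finset.mem_map, Finset.mem_filter, Finset.mem_univ, true_and]
        constructor
        · rintro ⟨e', he, rfl⟩; exact he
        · intro he; exact ⟨⟨e, hTG he⟩, he, rfl⟩
      refine ⟨Finset.univ.filter fun e => (e : Sym2 V) ∈ T, ?_, congrArg _ hT'⟩
      have h3 := hT2
      rw [← hT', htree] at h3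
      rw [Finset.mem_filter, Finset.mem_powersetCard_univ]
      exact ⟨h3.2, h3.1⟩
    · intro S _
      rw [map_prod]
      simp only [aeval_X]
      refine Finset.prod_congr ?_ fun _ _ => rfl
      ext e
      simp [hm]
  rw [hPhi, ← hKx]
  rcases Nat.even_or_odd (Fintype.card {u : V // u ≠ c}) with he | ho
  · rw [he.neg_one_pow, one_mul]
  · rw [ho.neg_one_pow, neg_one_mul, neg_eq_zero]
end tree
end PartH

section PartI
open MvPolynomial Matrix

theorem div_cast_aux (p Q N : ℕ) (hQ : 0 < Q) (Z Y : ℤ)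
    (h : (N : ℤ) = (Q : ℤ) ^ 2 * (Z + p * Y)) : ((N / Q ^ 2 : ℕ) : ZMod p) = (Z : ZMod p) := by
  have h1 : ((N / Q ^ 2 : ℕ) : ℤ) = Z + p * Y := by
    have hQ' : ((Q : ℤ) ^ 2) ≠ 0 := by positivity
    rw [Int.natCast_div, h, Nat.cast_pow]
    exact Int.mul_ediv_cancel_left _ hQ'
  have h2 := congrArg (Int.cast : ℤ → ZMod p) h1
  rw [Int.cast_natCast] at h2
  rw [h2]
  simp

section graphs
variable {V : Type} [Fintype V] [DecidableEq V]

lemma graph_facts (G : SimpleGraph V) [DecidableRel G.Adj] (hG : IsPrimitiveDivergent G) :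
    ∃ v a b c : V, a ≠ b ∧ a ≠ c ∧ b ≠ c ∧ (∀ u, G.Adj v u ↔ u = a ∨ u = b ∨ u = c) ∧
      (∀ u, G.degree u = 3 ∨ G.degree u = 4) ∧ G.edgeFinset.card + 2 = 2 * Fintype.card V := by
  classical
  obtain ⟨_, K, _, hK, _, hKG⟩ := hG
  let N : Finset V := Finset.univ.filter fun u => K.Adj none (some u)
  have hN : N.card = 4 := by
    rw [← hK none, ← Set.ncard_coe_finset, ← Set.ncard_image_of_injective _ (Option.some_injective V)]
    congr 1
    ext (_ | u)
    · simp
    · simp [N]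
  have hdeg : ∀ u, G.degree u + (if u ∈ N then 1 else 0) = 4 := by
    intro u
    have h1 : K.neighborSet (some u) = some '' (G.neighborFinset u : Set V) ∪ (if u ∈ N then {none} else ∅) := by
      ext (_ | w)
      · by_cases h : u ∈ N
        · have h' := h
          simp only [N, Finset.mem_filter, Finset.mem_univ, true_and] at h'
          simp [h, h'.symm]
        · have h' := h
          simp only [N, Finset.mem_filter, Finset.mem_univ, true_and] at h'
          simp [h, K.adj_comm (some u), h']
      · by_cases h : u ∈ N <;> simp [h, hKG]
    rw [← hK (some u), h1, Set.ncard_union_eq]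
    · rw [Set.ncard_image_of_injective _ (Option.some_injective V), Set.ncard_coe_finset, SimpleGraph.card_neighborFinset_eq_degree]
      split_ifs <;> simp
    · split_ifs <;> simp
  obtain ⟨v, hv⟩ : N.Nonempty := by rw [← Finset.card_pos]; omega
  have hd3 : (G.neighborFinset v).card = 3 := by
    have := hdeg v
    rw [if_pos hv] at this
    rw [SimpleGraph.card_neighborFinset_eq_degree]; omega
  obtain ⟨a, b, c, hab, hac, hbc, habc⟩ := Finset.card_eq_three.1 hd3
  refine ⟨v, a, b, c, hab, hac, hbc, ?_, ?_, ?_⟩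
  · intro u
    rw [← SimpleGraph.mem_neighborFinset, habc]
    simp
  · intro u
    have := hdeg u
    split_ifs at this <;> omega
  · have h1 := G.sum_degrees_eq_twice_card_edges
    have h2 : ∑ u, (G.degree u + (if u ∈ N then 1 else 0)) = 4 * Fintype.card V := by
      simp_rw [hdeg]; simp [mul_comm]
    rw [Finset.sum_add_distrib, h1] at h2
    simp [hN] at h2
    have h3 : (G.edgeFinset.card) = Finset.card G.edgeFinset := rfl
    omega

lemma RowS_of {R E : Type*} [Fintype R] [DecidableEq R] [Fintype E] [DecidableEq E]
    (B : Matrix R E ℤ) (w : R) (S : Finset E) (k : ℕ) (hS : S.card = k)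
    (h1 : ∀ e ∈ S, B w e * B w e = 1) (h0 : ∀ e, e ∉ S → B w e = 0) : RowS B w k := by
  let f := S.equivFinOfCardEq hS
  refine ⟨f.symm.toEmbedding.trans (Function.Embedding.subtype _), fun i => h1 _ (f.symm i).2, fun e he => h0 e fun h => he ?_⟩
  exact ⟨f ⟨e, h⟩, by simp⟩

lemma ThmC (G : SimpleGraph V) [DecidableRel G.Adj] (hG : IsPrimitiveDivergent G) (p : ℕ) [Fact p.Prime] :
    ∃ κ : ZMod p, ∀ s, 1 ≤ s → ((pointCount p s (kirchhoff G) / (p ^ s) ^ 2 : ℕ) : ZMod p) = - κ ^ s := by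
  classical
  obtain ⟨v, a, b, c, hab, hac, hbc, hv, hdeg, hcard⟩ := graph_facts G hG
  have hva : v ≠ a := ((hv a).2 (by simp)).ne
  have hvb : v ≠ b := ((hv b).2 (by simp)).ne
  have hvc : v ≠ c := ((hv c).2 (by simp)).ne
  have hor : ∀ e : ↥G.edgeFinset, ∃ t h : V, s(t, h) = (e : Sym2 V) ∧ (v ∈ (e : Sym2 V) → t = v) := by
    rintro ⟨e, he⟩
    by_cases h : v ∈ e
    · obtain ⟨w, hw⟩ := h
      exact ⟨v, w, hw.symm, fun _ => rfl⟩
    · induction e using Sym2.ind with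
      | _ x y => exact ⟨x, y, rfl, fun h' => absurd h' h⟩
  choose t h hth htv using hor
  have hne : ∀ e, t e ≠ h e := by
    intro e
    have := e.2
    rw [← hth e, SimpleGraph.mem_edgeFinset, SimpleGraph.mem_edgeSet] at this
    exact this.ne
  let nb : Fin 3 → V := ![a, b, c]
  have hnb : ∀ i, G.Adj v (nb i) := by
    intro i; rw [hv]; fin_cases i <;> simp [nb]
  have hnbinj : Function.Injective nb := by
    intro i j hij
    fin_cases i <;> fin_cases j <;> simp [nb, hab, hac, hbc, hab.symm, hac.symm, hbc.symm] at hij ⊢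
  have hnbsurj : ∀ u, G.Adj v u → ∃ i, nb i = u := by
    intro u hu
    rcases (hv u).1 hu with rfl | rfl | rfl
    · exact ⟨0, rfl⟩
    · exact ⟨1, rfl⟩
    · exact ⟨2, rfl⟩
  let cc : Fin 3 → ↥G.edgeFinset := fun i => ⟨s(v, nb i), by
    rw [SimpleGraph.mem_edgeFinset, SimpleGraph.mem_edgeSet]; exact hnb i⟩
  have hccinj : Function.Injective cc := by
    intro i j hij
    have h1 : s(v, nb i) = s(v, nb j) := congrArg Subtype.val hij
    exact hnbinj (Sym2.congr_right.1 h1)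
  have hcct : ∀ i, t (cc i) = v := fun i => htv _ (Sym2.mem_mk_left _ _)
  have hcch : ∀ i, h (cc i) = nb i := by
    intro i
    have h1 := hth (cc i)
    rw [hcct] at h1
    exact Sym2.congr_right.1 h1
  have hrange : ∀ e : ↥G.edgeFinset, e ∈ Set.range cc ↔ v ∈ (e : Sym2 V) := by
    intro e
    constructor
    · rintro ⟨i, rfl⟩; exact Sym2.mem_mk_left _ _
    · rintro ⟨w, hw⟩
      have hadj : G.Adj v w := by
        have := e.2
        rwa [hw, SimpleGraph.mem_edgeFinset, SimpleGraph.mem_edgeSet] at this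
      obtain ⟨i, hi⟩ := hnbsurj w hadj
      exact ⟨i, Subtype.ext (by rw [hw, ← hi])⟩
  let v' : {u : V // u ≠ c} := ⟨v, hvc⟩
  let R := {r : {u : V // u ≠ c} // r ≠ v'}
  let E' := {e : ↥G.edgeFinset // e ∉ Set.range cc}
  let f : Unit ⊕ R ≃ {u : V // u ≠ c} := Equiv.ofBijective (Sum.elim (fun _ => v') Subtype.val) (by
    constructor
    · rintro (x | x) (y | y) h
      · rfl
      · exact absurd h.symm y.2
      · exact absurd h x.2
      · exact congrArg _ (Subtype.ext h)
    · intro r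
      by_cases h : r = v'
      · exact ⟨.inl (), h.symm⟩
      · exact ⟨.inr ⟨r, h⟩, rfl⟩)
  let g : Fin 3 ⊕ E' ≃ ↥G.edgeFinset := Equiv.ofBijective (Sum.elim cc Subtype.val) (by
    constructor
    · rintro (x | x) (y | y) h
      · exact congrArg _ (hccinj h)
      · exact absurd ⟨x, h⟩ y.2
      · exact absurd ⟨y, h.symm⟩ x.2
      · exact congrArg _ (Subtype.ext h)
    · intro e
      by_cases h : e ∈ Set.range cc
      · obtain ⟨i, hi⟩ := h
        exact ⟨.inl i, hi⟩
      · exact ⟨.inr ⟨e, h⟩, rfl⟩)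
  let B : Matrix (Unit ⊕ R) (Fin 3 ⊕ E') ℤ := Matrix.of fun r e => Inc c t h (f r) (g e) * 1
  let M : Matrix R E' ℤ := B.submatrix .inr .inr
  have hBi : ∀ i, B (.inl ()) (.inl i) = 1 := by
    intro i
    change ((if v = t (cc i) then 1 else 0) - (if v = h (cc i) then 1 else 0) : ℤ) * 1 = 1
    rw [hcct, hcch, if_pos rfl, if_neg (hnb i).ne]; rfl
  have hB0 : ∀ e, B (.inl ()) (.inr e) = 0 := by
    intro e
    have he : v ∉ (e.1 : Sym2 V) := fun h => e.2 ((hrange _).2 h)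
    rw [← hth] at he
    rw [Sym2.mem_iff, not_or] at he
    change ((if v = t e.1 then 1 else 0) - (if v = h e.1 then 1 else 0) : ℤ) * 1 = 0
    rw [if_neg he.1, if_neg he.2]; rfl
  have hBr : ∀ (r : R) (i : Fin 3), B (.inr r) (.inl i) = - (if (r.1 : V) = nb i then 1 else 0) := by
    intro r i
    change ((if (r.1 : V) = t (cc i) then 1 else 0) - (if (r.1 : V) = h (cc i) then 1 else 0) : ℤ) * 1 = _
    have : (r.1 : V) ≠ v := fun h => r.2 (Subtype.ext h)
    rw [hcct, hcch, if_neg this]; ring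
  let a' : R := ⟨⟨a, hac⟩, fun h => hva (congrArg Subtype.val h).symm⟩
  let b' : R := ⟨⟨b, hbc⟩, fun h => hvb (congrArg Subtype.val h).symm⟩
  have hab' : a' ≠ b' := fun h => hab (congrArg (fun r : R => (r.1 : V)) h)
  have hu0 : (fun r => B (.inr r) (.inl 0)) = Pi.single a' (-1) := by
    ext r
    rw [hBr, Pi.single_apply]
    have : ((r.1 : V) = nb 0) ↔ r = a' := ⟨fun h => Subtype.ext (Subtype.ext h), fun h => h ▸ rfl⟩
    simp only [this]
    split_ifs <;> simp
  have hu1 : (fun r => B (.inr r) (.inl 1)) = Pi.single b' (-1) := by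
    ext r
    rw [hBr, Pi.single_apply]
    have : ((r.1 : V) = nb 1) ↔ r = b' := ⟨fun h => Subtype.ext (Subtype.ext h), fun h => h ▸ rfl⟩
    simp only [this]
    split_ifs <;> simp
  have hu2 : (fun r => B (.inr r) (.inl 2)) = 0 := by
    ext r
    rw [hBr, if_neg (show (r.1 : V) ≠ nb 2 from r.1.2)]; rfl
  have hrow : ∀ (w : R) (i : Fin 3), (w.1 : V) = nb i → RowS M w 2 ∨ RowS M w 3 := by
    intro w i hw
    have hwv : (w.1 : V) ≠ v := by rw [hw]; exact (hnb i).ne'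
    let S : Finset E' := Finset.univ.filter fun e => (w.1 : V) ∈ (e.1 : Sym2 V)
    have hS : S.card + 1 = G.degree w.1 := by
      have h1 : S.image (fun e => (e.1 : Sym2 V)) = (G.incidenceFinset w.1).erase s(v, nb i) := by
        ext e
        simp only [Finset.mem_image, Finset.mem_erase, S, Finset.mem_filter, Finset.mem_univ, true_and, SimpleGraph.mem_incidenceFinset]
        constructor
        · rintro ⟨e', he', rfl⟩
          refine ⟨?_, SimpleGraph.mem_edgeFinset.1 e'.1.2, he'⟩
          intro h; exact e'.2 ⟨i, Subtype.ext h.symm⟩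
        · rintro ⟨h1, h2, h3⟩
          refine ⟨⟨⟨e, SimpleGraph.mem_edgeFinset.2 h2⟩, ?_⟩, h3, rfl⟩
          rintro ⟨j, hj⟩
          have hj' : s(v, nb j) = e := congrArg Subtype.val hj
          rw [← hj', Sym2.mem_iff] at h3
          rcases h3 with h3 | h3
          · exact hwv h3
          · apply h1; rw [← hj', ← h3, hw]
      have h2 : S.card = ((G.incidenceFinset w.1).erase s(v, nb i)).card := by
        rw [← h1, Finset.card_image_of_injective]
        intro x y hxy
        exact Subtype.ext (Subtype.ext hxy)
      rw [h2, Finset.card_erase_add_one, SimpleGraph.card_incidenceFinset_eq_degree]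
      rw [SimpleGraph.mem_incidenceFinset]
      refine ⟨hnb i, ?_⟩
      rw [hw]; exact Sym2.mem_mk_right _ _
    have hM : ∀ e : E', M w e = ((if (w.1 : V) = t e.1 then 1 else 0) - (if (w.1 : V) = h e.1 then 1 else 0) : ℤ) := by
      intro e; exact mul_one _
    have hrS : ∀ k, S.card = k → RowS M w k := by
      intro k hk
      refine RowS_of M w S k hk ?_ ?_
      · intro e he
        have he' : (w.1 : V) ∈ (e.1 : Sym2 V) := (Finset.mem_filter.1 he).2
        rw [← hth, Sym2.mem_iff] at he'
        have := hne e.1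
        rw [hM]
        rcases he' with h1 | h1
        · rw [if_pos h1, if_neg (by rw [h1]; exact this)]; norm_num
        · rw [if_pos h1, if_neg (by rw [h1]; exact this.symm)]; norm_num
      · intro e he
        have he' : (w.1 : V) ∉ (e.1 : Sym2 V) := fun h => he (Finset.mem_filter.2 ⟨Finset.mem_univ _, h⟩)
        rw [← hth, Sym2.mem_iff, not_or] at he'
        rw [hM, if_neg he'.1, if_neg he'.2]; rfl
    rcases hdeg w.1 with h3 | h3
    · exact Or.inl (hrS 2 (by omega))
    · exact Or.inr (hrS 3 (by omega))
  have cV : 4 ≤ Fintype.card V := by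
    have : ({v, a, b, c} : Finset V).card = 4 := by
      rw [Finset.card_insert_of_notMem, Finset.card_insert_of_notMem, Finset.card_insert_of_notMem, Finset.card_singleton]
      · simpa using hbc
      · simp [hab, hac]
      · simp [hva, hvb, hvc]
    rw [← this]; exact Finset.card_le_univ _
  have cc1 : Fintype.card {u : V // u ≠ c} = Fintype.card V - 1 := by
    rw [Fintype.card_subtype_compl, Fintype.card_subtype_eq]
  have cR : Fintype.card R + 1 = Fintype.card V - 1 := by
    have := Fintype.card_congr f
    rw [Fintype.card_sum, Fintype.card_unit] at this
    omega
  have cE : Fintype.card E' + 3 = G.edgeFinset.card := by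
    have := Fintype.card_congr g
    rw [Fintype.card_sum, Fintype.card_fin, Fintype.card_coe] at this
    omega
  refine ⟨coeff (cst E' (p - 1)) ((PhiP (ZMod p) M * AdjP (ZMod p) M a' b') ^ (p - 1)), ?_⟩
  intro s hs
  let F := GaloisField p s
  haveI : Fintype F := Fintype.ofFinite F
  have hF : Fintype.card F = p ^ s := by
    rw [← Nat.card_eq_fintype_card]; exact GaloisField.card p s (by omega)
  have hpc : (pointCount p s (kirchhoff G) : ℤ) = cnt (fun x : Fin 3 ⊕ E' → F => Phi B x = 0) := by
    unfold pointCount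
    rw [← cnt_eq_card]
    rw [cnt_congr (fun x => kirchhoff_zero_iff' G c t h hth x)]
    exact cnt_reindex _ f g (fun _ => 1) (fun _ => rfl)
  have : CharP F p := inferInstanceAs (CharP (GaloisField p s) p)
  obtain ⟨Y, hY⟩ := ThmA (F := F) p B hBi hB0 a' b' hab' (-1) (-1) (by norm_num) (by norm_num) hu0 hu1 hu2
    (hrow a' 0 rfl) (hrow b' 1 rfl) (by omega) (by omega)
  have hB := ThmB (F := F) p s hF M a' b' (by omega) (by omega)
  rw [← hB]
  rw [hF] at hY
  rw [hY] at hpc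
  exact div_cast_aux p (p ^ s) _ (pow_pos (Fact.out : p.Prime).pos s) _ Y hpc
end graphs
end PartI

/-- For primitive divergent graphs `G₁, G₂`, a prime `p`, `s ≥ 1`,
`q = p^s`, with the appropriate divisibilities: if `c₂^{(p)}(G₁) ≡ c₂^{(p)}(G₂) (mod p)`
then `c₂^{(q)}(G₁) ≡ c₂^{(q)}(G₂) (mod p)`. -/
theorem statement1 {V₁ V₂ : Type} [Fintype V₁] [DecidableEq V₁] [Fintype V₂] [DecidableEq V₂]
    (G₁ : SimpleGraph V₁) [DecidableRel G₁.Adj] (G₂ : SimpleGraph V₂) [DecidableRel G₂.Adj]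
    (hG₁ : IsPrimitiveDivergent G₁) (hG₂ : IsPrimitiveDivergent G₂)
    (p s : ℕ) [Fact p.Prime] (hs : 1 ≤ s)
    (hdivp₁ : p ^ 2 ∣ pointCount p 1 (kirchhoff G₁))
    (hdivp₂ : p ^ 2 ∣ pointCount p 1 (kirchhoff G₂))
    (hdivq₁ : (p ^ s) ^ 2 ∣ pointCount p s (kirchhoff G₁))
    (hdivq₂ : (p ^ s) ^ 2 ∣ pointCount p s (kirchhoff G₂))
    (hp : ((pointCount p 1 (kirchhoff G₁) / p ^ 2 : ℕ) : ZMod p)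
        = ((pointCount p 1 (kirchhoff G₂) / p ^ 2 : ℕ) : ZMod p)) :
    ((pointCount p s (kirchhoff G₁) / (p ^ s) ^ 2 : ℕ) : ZMod p)
      = ((pointCount p s (kirchhoff G₂) / (p ^ s) ^ 2 : ℕ) : ZMod p) := by
  obtain ⟨κ₁, h₁⟩ := ThmC G₁ hG₁ p
  obtain ⟨κ₂, h₂⟩ := ThmC G₂ hG₂ p
  have e₁ := h₁ 1 le_rfl
  have e₂ := h₂ 1 le_rfl
  rw [pow_one] at e₁ e₂
  rw [e₁, e₂, pow_one, pow_one] at hp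
  rw [h₁ s hs, h₂ s hs, neg_injective hp]
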